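/- arXiv:1203.6086 — 3 statements merged into one kernel-verified Lean document; each statement's English description precedes it below -/
import Mathlib

section
/- Let 𝒰 be a strict Fraïssé class of finite structures over a relational signature, let 𝒞 be a Fraïssé class that is free in 𝒰, and let T be a countable structure with Age(T) ⊆ 𝒰. Assume additionally that the Fraïssé limit of 𝒞 is finite or has an oligomorphic automorphism group, and that T is finite or Aut(T) is oligomorphic. Then there is a countable structure U with Age(U) ⊆ 𝒞 and a homomorphism U → T such that every countable structure A with Age(A) ⊆ 𝒞 and A → T embeds into U, and such that Aut(U) is oligomorphic. -/
open FirstOrder Language CategoryTheory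

universe u v

namespace Stmt4

/-- The automorphism group of `M` is oligomorphic: for every `n` there are only finitely
many orbits on `n`-tuples. -/
def AutOligomorphic (L : FirstOrder.Language.{u, v}) (M : Type*) [L.Structure M] : Prop :=
  ∀ n : ℕ, ∃ S : Set (Fin n → M), S.Finite ∧
    ∀ x : Fin n → M, ∃ y ∈ S, ∃ g : M ≃[L] M, ⇑g ∘ y = x

variable {L : FirstOrder.Language.{u, v}}

/-- The age of `M` is contained in the class `C` of finite structures. -/
def AgeIn (C : Set (Bundled.{0} L.Structure)) (M : Type*) [L.Structure M] : Prop :=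
  ∀ A : Bundled.{0} L.Structure, Finite A → Nonempty (A ↪[L] M) → A ∈ C

/-- `A` is a countable structure whose age is contained in `C`, i.e. `A ∈ C̄`. -/
def InBar (C : Set (Bundled.{0} L.Structure)) (A : Bundled.{0} L.Structure) : Prop :=
  Countable A ∧ AgeIn C A

/-- A Fraïssé class of finite structures: nonempty, isomorphism-closed, countably many
isomorphism types, hereditary, with the joint embedding and amalgamation properties. -/
structure IsFraisseClass (C : Set (Bundled.{0} L.Structure)) : Prop where
  nonempty : C.Nonempty
  finite : ∀ A ∈ C, Finite A
  isoInvariant : ∀ A B : Bundled.{0} L.Structure, Nonempty (A ≃[L] B) → (A ∈ C ↔ B ∈ C)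
  countableTypes : ∃ S : Set (Bundled.{0} L.Structure), S.Countable ∧
    ∀ A ∈ C, ∃ B ∈ S, Nonempty (A ≃[L] B)
  hereditary : ∀ A ∈ C, ∀ B : Bundled.{0} L.Structure, Finite B → Nonempty (B ↪[L] A) → B ∈ C
  jep : ∀ A ∈ C, ∀ B ∈ C, ∃ D ∈ C, Nonempty (A ↪[L] D) ∧ Nonempty (B ↪[L] D)
  amalgamation : ∀ A B₁ B₂ : Bundled.{0} L.Structure, A ∈ C → B₁ ∈ C → B₂ ∈ C →
    ∀ (f₁ : A ↪[L] B₁) (f₂ : A ↪[L] B₂),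
      ∃ (D : Bundled.{0} L.Structure) (_ : D ∈ C) (g₁ : B₁ ↪[L] D) (g₂ : B₂ ↪[L] D),
        ∀ x, g₁ (f₁ x) = g₂ (f₂ x)

/-- `(P, g₁, g₂)` is a pushout of the pair of embeddings `(f₁, f₂)` in the category
`(K̄, →)` of countable structures with age contained in `K`, with homomorphisms. -/
def IsPushoutIn (K : Set (Bundled.{0} L.Structure)) {A B₁ B₂ : Bundled.{0} L.Structure}
    (f₁ : A ↪[L] B₁) (f₂ : A ↪[L] B₂) (P : Bundled.{0} L.Structure)
    (g₁ : B₁ →[L] P) (g₂ : B₂ →[L] P) : Prop :=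
  InBar K P ∧ (∀ x, g₁ (f₁ x) = g₂ (f₂ x)) ∧
  ∀ D : Bundled.{0} L.Structure, InBar K D →
    ∀ (h₁ : B₁ →[L] D) (h₂ : B₂ →[L] D), (∀ x, h₁ (f₁ x) = h₂ (f₂ x)) →
      ∃! h : P →[L] D, h.comp g₁ = h₁ ∧ h.comp g₂ = h₂

/-- `(P, g₁, g₂)` is a coproduct of `B₁, B₂` in the category `(K̄, →)`. -/
def IsCoproductIn (K : Set (Bundled.{0} L.Structure)) (B₁ B₂ P : Bundled.{0} L.Structure)
    (g₁ : B₁ →[L] P) (g₂ : B₂ →[L] P) : Prop :=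
  InBar K P ∧
  ∀ D : Bundled.{0} L.Structure, InBar K D → ∀ (h₁ : B₁ →[L] D) (h₂ : B₂ →[L] D),
    ∃! h : P →[L] D, h.comp g₁ = h₁ ∧ h.comp g₂ = h₂

/-- A strict Fraïssé class: a Fraïssé class in which every pair of embeddings with common
domain has a pushout in `(K̄,→)`, and every pair of members has a coproduct in `(K̄,→)`. -/
def IsStrictFraisse (K : Set (Bundled.{0} L.Structure)) : Prop :=
  IsFraisseClass K ∧
  (∀ A B₁ B₂ : Bundled.{0} L.Structure, A ∈ K → B₁ ∈ K → B₂ ∈ K →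
    ∀ (f₁ : A ↪[L] B₁) (f₂ : A ↪[L] B₂),
      ∃ (P : Bundled.{0} L.Structure) (g₁ : B₁ →[L] P) (g₂ : B₂ →[L] P),
        IsPushoutIn K f₁ f₂ P g₁ g₂) ∧
  (∀ B₁ B₂ : Bundled.{0} L.Structure, B₁ ∈ K → B₂ ∈ K →
    ∃ (P : Bundled.{0} L.Structure) (g₁ : B₁ →[L] P) (g₂ : B₂ →[L] P),
      IsCoproductIn K B₁ B₂ P g₁ g₂)

/-- `C` is free in the strict Fraïssé class `K`: `C ⊆ K` and `C` is closed under the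
canonical (pushout) amalgams and under finite coproducts taken in `(K̄,→)`. -/
def IsFreeIn (C K : Set (Bundled.{0} L.Structure)) : Prop :=
  C ⊆ K ∧
  (∀ A B₁ B₂ : Bundled.{0} L.Structure, A ∈ C → B₁ ∈ C → B₂ ∈ C →
    ∀ (f₁ : A ↪[L] B₁) (f₂ : A ↪[L] B₂) (P : Bundled.{0} L.Structure)
      (g₁ : B₁ →[L] P) (g₂ : B₂ →[L] P), IsPushoutIn K f₁ f₂ P g₁ g₂ → P ∈ C) ∧
  (∀ B₁ B₂ : Bundled.{0} L.Structure, B₁ ∈ C → B₂ ∈ C →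
    ∀ (P : Bundled.{0} L.Structure) (g₁ : B₁ →[L] P) (g₂ : B₂ →[L] P),
      IsCoproductIn K B₁ B₂ P g₁ g₂ → P ∈ C)

/-- `F` is a Fraïssé limit of the class `C`: a countable structure whose age is exactly
`C` and which is ultrahomogeneous. -/
def IsFraisseLimitOf (C : Set (Bundled.{0} L.Structure)) (F : Bundled.{0} L.Structure) : Prop :=
  Countable F ∧
  (∀ A : Bundled.{0} L.Structure, Finite A → (A ∈ C ↔ Nonempty (A ↪[L] F))) ∧
  ∀ A : Bundled.{0} L.Structure, Finite A → ∀ f g : A ↪[L] F,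
    ∃ h : F ≃[L] F, ∀ x, h (f x) = g x

/-! ### Relational structures and maps between them -/

/-- The structure over a relational language with prescribed relations. -/
@[reducible] def ofRel [L.IsRelational] {X : Type*}
    (r : ∀ {n}, L.Relations n → (Fin n → X) → Prop) : L.Structure X where
  funMap f := isEmptyElim f
  RelMap := r

/-- The bundled structure over a relational language with prescribed relations. -/
def bundledOfRel [L.IsRelational] {X : Type}
    (r : ∀ {n}, L.Relations n → (Fin n → X) → Prop) : Bundled.{0} L.Structure :=
  ⟨X, ofRel r⟩

/-- The structure induced on `X` by a map into a relational structure. -/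
@[reducible] def pull [L.IsRelational] {X M : Type*} [L.Structure M] (f : X → M) :
    L.Structure X :=
  ofRel fun R v => Structure.RelMap R (f ∘ v)

/-- Over a relational language an injective map preserving and reflecting relations is an
embedding. -/
def mkEmbedding [L.IsRelational] {M N : Type*} [L.Structure M] [L.Structure N] (f : M → N)
    (hf : Function.Injective f)
    (hr : ∀ {n} (R : L.Relations n) (v : Fin n → M),
      Structure.RelMap R (f ∘ v) ↔ Structure.RelMap R v) : M ↪[L] N where
  toFun := f
  inj' := hf
  map_fun' g := isEmptyElim g
  map_rel' := hr

/-- The bundled structure induced on `X` by a map into a relational structure. -/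
def induced [L.IsRelational] {X : Type} {M : Type*} [L.Structure M] (f : X → M) :
    Bundled.{0} L.Structure :=
  ⟨X, pull f⟩

/-- An injective map is an embedding of the structure it induces on its domain. -/
def inducedEmbedding [L.IsRelational] {X : Type} {M : Type*} [L.Structure M] (f : X → M)
    (hf : Function.Injective f) : induced (L := L) f ↪[L] M :=
  mkEmbedding (M := induced (L := L) f) f hf fun _ _ => Iff.rfl

/-- Over a relational language a map preserving relations is a homomorphism. -/
def mkHom [L.IsRelational] {M N : Type*} [L.Structure M] [L.Structure N] (f : M → N)
    (hr : ∀ {n} (R : L.Relations n) (v : Fin n → M),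
      Structure.RelMap R v → Structure.RelMap R (f ∘ v)) : M →[L] N where
  toFun := f
  map_fun' g := isEmptyElim g
  map_rel' := hr

/-! ### Amalgamation over `T` -/

/-- Structures in `C` equipped with homomorphisms to `T` have the amalgamation property. -/
theorem exists_amalgam_over [L.IsRelational] {U C : Set (Bundled.{0} L.Structure)}
    (hU : IsStrictFraisse U) (hfree : IsFreeIn C U)
    {T : Type} [L.Structure T] [Countable T] (hT : AgeIn U T)
    {A B₁ B₂ : Bundled.{0} L.Structure} (hA : A ∈ C) (hB₁ : B₁ ∈ C) (hB₂ : B₂ ∈ C)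
    (f₁ : A ↪[L] B₁) (f₂ : A ↪[L] B₂) (b₁ : B₁ →[L] T) (b₂ : B₂ →[L] T)
    (hb : ∀ x, b₁ (f₁ x) = b₂ (f₂ x)) :
    ∃ D ∈ C, ∃ (g₁ : B₁ ↪[L] D) (g₂ : B₂ ↪[L] D) (d : D →[L] T),
      (∀ x, g₁ (f₁ x) = g₂ (f₂ x)) ∧ (∀ x, d (g₁ x) = b₁ x) ∧ ∀ x, d (g₂ x) = b₂ x := by
  obtain ⟨hF, hpo, -⟩ := hU
  obtain ⟨hCU, hCpo, -⟩ := hfree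
  obtain ⟨P, g₁, g₂, hP⟩ := hpo A B₁ B₂ (hCU hA) (hCU hB₁) (hCU hB₂) f₁ f₂
  have hPC := hCpo A B₁ B₂ hA hB₁ hB₂ f₁ f₂ P g₁ g₂ hP
  obtain ⟨-, hcomm, huniv⟩ := hP
  obtain ⟨D, hD, k₁, k₂, hk⟩ := hF.amalgamation A B₁ B₂ (hCU hA) (hCU hB₁) (hCU hB₂) f₁ f₂
  have hDbar : InBar U D :=
    ⟨@Finite.to_countable _ (hF.finite D hD), fun A hA h => hF.hereditary D hD A hA h⟩
  obtain ⟨h, ⟨hh₁, hh₂⟩, -⟩ := huniv D hDbar k₁.toHom k₂.toHom hk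
  obtain ⟨d, ⟨hd₁, hd₂⟩, -⟩ := huniv ⟨T, inferInstance⟩ ⟨‹_›, hT⟩ b₁ b₂ hb
  have key : ∀ {B : Bundled.{0} L.Structure} (g : B →[L] P) (k : B ↪[L] D),
      h.comp g = k.toHom → ∃ g' : B ↪[L] P, ∀ x, g' x = g x := by
    intro B g k hgk
    have hx : ∀ x, h (g x) = k x := fun x => DFunLike.congr_fun hgk x
    refine ⟨mkEmbedding g (fun x y hxy => k.injective ?_) fun R v => ⟨fun hR => ?_, g.map_rel R v⟩,
      fun _ => rfl⟩
    · rw [← hx, ← hx, hxy]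
    · rw [← k.map_rel]
      have := h.map_rel R _ hR
      rwa [show h ∘ g ∘ v = k ∘ v from funext fun i => hx (v i)] at this
  obtain ⟨g₁', h₁⟩ := key g₁ k₁ hh₁
  obtain ⟨g₂', h₂⟩ := key g₂ k₂ hh₂
  refine ⟨P, hPC, g₁', g₂', d, fun x => ?_, fun x => ?_, fun x => ?_⟩
  · rw [h₁, h₂, hcomm]
  · rw [h₁]; exact DFunLike.congr_fun hd₁ x
  · rw [h₂]; exact DFunLike.congr_fun hd₂ x

/-! ### Extension property and back-and-forth -/

/-- The extension property of `M` with respect to members of `C` coloured by homomorphisms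
to `T`. -/
def ExtensionProperty (C : Set (Bundled.{0} L.Structure)) (T : Type*) [L.Structure T]
    (M : Type*) [L.Structure M] (u : M → T) : Prop :=
  ∀ A B : Bundled.{0} L.Structure, B ∈ C → ∀ (f : A ↪[L] B) (b : B →[L] T) (e : A ↪[L] M),
    (∀ x, u (e x) = b (f x)) → ∃ g : B ↪[L] M, (∀ x, g (f x) = e x) ∧ ∀ x, u (g x) = b x

/-- A finite set of pairs that is a partial isomorphism compatible with the colourings
`m` and `n`. -/
structure IsPartialIso (L : FirstOrder.Language.{u, v}) {T M N : Type*} [L.Structure M]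
    [L.Structure N] (m : M → T) (n : N → T) (f : Finset (M × N)) : Prop where
  inj : ∀ p ∈ f, ∀ q ∈ f, p.1 = q.1 ↔ p.2 = q.2
  rel : ∀ {k} (R : L.Relations k) (w : Fin k → M × N), (∀ i, w i ∈ f) →
    (Structure.RelMap R (Prod.fst ∘ w) ↔ Structure.RelMap R (Prod.snd ∘ w))
  col : ∀ p ∈ f, m p.1 = n p.2

namespace IsPartialIso

variable {T M N : Type*} [L.Structure M] [L.Structure N] {m : M → T} {n : N → T}

theorem swap [DecidableEq (N × M)] {f : Finset (M × N)} (hf : IsPartialIso L m n f) :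
    IsPartialIso L n m (f.image Prod.swap) where
  inj p hp q hq := by
    simp only [Finset.mem_image, Prod.exists] at hp hq
    obtain ⟨a, b, hp, rfl⟩ := hp
    obtain ⟨c, d, hq, rfl⟩ := hq
    exact (hf.inj _ hp _ hq).symm
  rel R w hw := by
    refine (hf.rel R (Prod.swap ∘ w) fun i => ?_).symm
    obtain ⟨p, hp, h⟩ := Finset.mem_image.1 (hw i)
    simpa [← h] using hp
  col p hp := by
    obtain ⟨q, hq, rfl⟩ := Finset.mem_image.1 hp
    exact (hf.col _ hq).symm

end IsPartialIso

/-- The forth step: a partial isomorphism into a structure with the extension property can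
be extended to one more element of its source. -/
theorem ExtensionProperty.forth [L.IsRelational] {C : Set (Bundled.{0} L.Structure)}
    {T : Type*} [L.Structure T] {M N : Type} [L.Structure M] [L.Structure N]
    {n : N → T} (hN : ExtensionProperty C T N n) (hM : AgeIn C M) (m : M →[L] T)
    {f : Finset (M × N)} (hf : IsPartialIso L m n f) (a : M) :
    ∃ g : Finset (M × N), IsPartialIso L m n g ∧ f ⊆ g ∧ ∃ b, (a, b) ∈ g := by
  classical
  let s : Finset M := insert a (f.image Prod.fst)
  let A : Bundled.{0} L.Structure := induced fun p : {p // p ∈ f} => p.1.1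
  let B : Bundled.{0} L.Structure := induced fun x : {x // x ∈ s} => x.1
  have hB : B ∈ C := hM B (inferInstanceAs (Finite {x // x ∈ s}))
    ⟨inducedEmbedding _ Subtype.val_injective⟩
  let i : A ↪[L] B := mkEmbedding (M := A) (N := B)
    (fun p => ⟨p.1.1, Finset.mem_insert_of_mem (Finset.mem_image_of_mem _ p.2)⟩)
    (fun p q h => by
      have h1 : p.1.1 = q.1.1 := congrArg Subtype.val h
      exact Subtype.ext (Prod.ext h1 ((hf.inj _ p.2 _ q.2).1 h1)))
    (fun R v => Iff.rfl)
  let e : A ↪[L] N := mkEmbedding (M := A) (fun p => p.1.2)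
    (fun p q h => Subtype.ext (Prod.ext ((hf.inj _ p.2 _ q.2).2 h) h))
    (fun R v => (hf.rel R (fun i => (v i).1) fun i => (v i).2).symm)
  let b : B →[L] T := mkHom (M := B) (fun x => m x.1) fun R v h => m.map_rel R _ h
  obtain ⟨g, hg, hgc⟩ := hN A B hB i b e fun p => (hf.col _ p.2).symm
  have hinj := g.injective
  refine ⟨s.attach.image fun x => (x.1, g x), ⟨?_, ?_, ?_⟩, ?_, g ⟨a, Finset.mem_insert_self _ _⟩,
    ?_⟩
  · intro p hp q hq
    obtain ⟨x, -, rfl⟩ := Finset.mem_image.1 hp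
    obtain ⟨y, -, rfl⟩ := Finset.mem_image.1 hq
    exact ⟨fun h => congrArg g (Subtype.ext h), fun h => congrArg Subtype.val (hinj h)⟩
  · intro k R w hw
    choose x _ hx using fun i => Finset.mem_image.1 (hw i)
    have hw' : w = fun i => ((x i).1, g (x i)) := funext fun i => (hx i).symm
    subst hw'
    exact (g.map_rel R (fun i => (x i : B))).symm
  · intro p hp
    obtain ⟨x, -, rfl⟩ := Finset.mem_image.1 hp
    exact (hgc x).symm
  · intro p hp
    refine Finset.mem_image.2 ⟨(i ⟨p, hp⟩ : B), Finset.mem_attach _ _, ?_⟩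
    exact Prod.ext rfl (hg ⟨p, hp⟩)
  · exact Finset.mem_image.2 ⟨⟨a, Finset.mem_insert_self _ _⟩, Finset.mem_attach _ _, rfl⟩

/-- If partial isomorphisms can be extended to every element of `M`, and to every element of
`K` in their range, then every partial isomorphism extends to an embedding with `K` in its
range. -/
theorem IsPartialIso.exists_embedding [L.IsRelational] {T M N : Type*} [L.Structure M]
    [L.Structure N] [Countable M] [Countable N] {m : M → T} {n : N → T} (K : Set N)
    (forth : ∀ f, IsPartialIso L m n f → ∀ a : M,
      ∃ g, IsPartialIso L m n g ∧ f ⊆ g ∧ ∃ b, (a, b) ∈ g)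
    (back : ∀ f, IsPartialIso L m n f → ∀ b ∈ K,
      ∃ g, IsPartialIso L m n g ∧ f ⊆ g ∧ ∃ a, (a, b) ∈ g)
    {f₀ : Finset (M × N)} (hf₀ : IsPartialIso L m n f₀) :
    ∃ h : M ↪[L] N, (∀ p ∈ f₀, h p.1 = p.2) ∧ K ⊆ Set.range h := by
  classical
  let P := {f : Finset (M × N) // IsPartialIso L m n f}
  let 𝒟 : M ⊕ K → Order.Cofinal P := Sum.elim
    (fun a => ⟨{f | ∃ b, (a, b) ∈ f.1}, fun f => by
      obtain ⟨g, hg, hfg, hb⟩ := forth f.1 f.2 a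
      exact ⟨⟨g, hg⟩, hb, hfg⟩⟩)
    (fun b => ⟨{f | ∃ a, (a, b.1) ∈ f.1}, fun f => by
      obtain ⟨g, hg, hfg, ha⟩ := back f.1 f.2 b.1 b.2
      exact ⟨⟨g, hg⟩, ha, hfg⟩⟩)
  have := Encodable.ofCountable (M ⊕ K)
  let I := Order.idealOfCofinals (⟨f₀, hf₀⟩ : P) 𝒟
  have hmeet := Order.cofinal_meets_idealOfCofinals (⟨f₀, hf₀⟩ : P) 𝒟
  have hex : ∀ a : M, ∃ b, ∃ f ∈ I, (a, b) ∈ f.1 := fun a => by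
    obtain ⟨f, ⟨b, hb⟩, hf⟩ := hmeet (.inl a)
    exact ⟨b, f, hf, hb⟩
  choose h F hF hh using hex
  have hbound : ∀ {f g : P}, f ∈ I → g ∈ I → ∃ k ∈ I, f.1 ⊆ k.1 ∧ g.1 ⊆ k.1 :=
    fun hf hg => I.directed _ hf _ hg
  have hval : ∀ f ∈ I, ∀ p ∈ f.1, h p.1 = p.2 := fun f hf p hp => by
    obtain ⟨k, -, hk₁, hk₂⟩ := hbound hf (hF p.1)
    exact (k.2.inj _ (hk₂ (hh p.1)) _ (hk₁ hp)).1 rfl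
  have hfin : ∀ s : Finset M, ∃ f ∈ I, ∀ x ∈ s, (x, h x) ∈ f.1 := fun s => by
    induction s using Finset.induction_on with
    | empty => exact ⟨_, Order.mem_idealOfCofinals _ 𝒟, by simp⟩
    | insert a s _ ih =>
      obtain ⟨f, hf, hfs⟩ := ih
      obtain ⟨k, hk, hk₁, hk₂⟩ := hbound hf (hF a)
      refine ⟨k, hk, fun x hx => ?_⟩
      obtain rfl | hx := Finset.mem_insert.1 hx
      · exact hk₂ (hh x)
      · exact hk₁ (hfs x hx)
  refine ⟨mkEmbedding h (fun x y hxy => ?_) fun R v => ?_, fun p hp => ?_, fun b hb => ?_⟩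
  · obtain ⟨f, -, hf⟩ := hfin {x, y}
    exact (f.2.inj _ (hf x (by simp)) _ (hf y (by simp))).2 hxy
  · obtain ⟨f, -, hf⟩ := hfin (Finset.univ.image v)
    exact (f.2.rel R (fun i => (v i, h (v i))) fun i => hf _ (by simp)).symm
  · exact hval _ (Order.mem_idealOfCofinals _ 𝒟) p hp
  · obtain ⟨f, ⟨a, ha⟩, hf⟩ := hmeet (.inr ⟨b, hb⟩)
    exact ⟨a, hval f hf _ ha⟩

/-- A partial isomorphism between two countable structures with the extension property extends to
an isomorphism. -/
theorem ExtensionProperty.exists_equiv [L.IsRelational] {C : Set (Bundled.{0} L.Structure)}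
    {T : Type*} [L.Structure T] {M N : Type} [L.Structure M] [L.Structure N]
    [Countable M] [Countable N] (m : M →[L] T) (n : N →[L] T) (hM : AgeIn C M) (hN : AgeIn C N)
    (hm : ExtensionProperty C T M m) (hn : ExtensionProperty C T N n)
    {f : Finset (M × N)} (hf : IsPartialIso L m n f) :
    ∃ h : M ≃[L] N, ∀ p ∈ f, h p.1 = p.2 := by
  classical
  obtain ⟨h, hh, hr⟩ := IsPartialIso.exists_embedding Set.univ
    (fun f hf a => hn.forth hM m hf a)
    (fun f hf b _ => by
      obtain ⟨g, hg, hfg, a, ha⟩ := hm.forth hN n hf.swap b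
      refine ⟨g.image Prod.swap, hg.swap, fun p hp => ?_, a, Finset.mem_image_of_mem _ ha⟩
      exact Finset.mem_image.2 ⟨p.swap, hfg (Finset.mem_image_of_mem _ hp), p.swap_swap⟩) hf
  exact ⟨⟨Equiv.ofBijective h ⟨h.injective, fun y => hr (Set.mem_univ y)⟩,
    fun g => isEmptyElim g, fun R v => h.map_rel R v⟩, hh⟩

/-- All members of a class with the joint embedding property agree on nullary relations. -/
theorem IsFraisseClass.relMap_iff_of_isEmpty {C : Set (Bundled.{0} L.Structure)}
    (hC : IsFraisseClass C) {A B : Bundled.{0} L.Structure} (hA : A ∈ C) (hB : B ∈ C)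
    {k} (hk : IsEmpty (Fin k)) (R : L.Relations k) (v : Fin k → A) (w : Fin k → B) :
    Structure.RelMap R v ↔ Structure.RelMap R w := by
  obtain ⟨D, -, ⟨i⟩, ⟨j⟩⟩ := hC.jep A hA B hB
  rw [← i.map_rel, ← j.map_rel, Subsingleton.elim (i ∘ v) (j ∘ w)]

/-- Structures whose ages lie in a class with the joint embedding property agree on nullary
relations. -/
theorem AgeIn.relMap_iff_of_isEmpty [L.IsRelational] {C : Set (Bundled.{0} L.Structure)}
    (hC : IsFraisseClass C) {M N : Type} [L.Structure M] [L.Structure N]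
    (hM : AgeIn C M) (hN : AgeIn C N) {k} (hk : IsEmpty (Fin k)) (R : L.Relations k)
    (v : Fin k → M) (w : Fin k → N) :
    Structure.RelMap R v ↔ Structure.RelMap R w := by
  let A : Bundled.{0} L.Structure := induced (M := M) Empty.elim
  let B : Bundled.{0} L.Structure := induced (M := N) Empty.elim
  let i : A ↪[L] M := inducedEmbedding _ fun x => x.elim
  let j : B ↪[L] N := inducedEmbedding _ fun x => x.elim
  have hA : A ∈ C := hM A (inferInstanceAs (Finite Empty)) ⟨i⟩
  have hB : B ∈ C := hN B (inferInstanceAs (Finite Empty)) ⟨j⟩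
  have := hC.relMap_iff_of_isEmpty hA hB hk R (fun x => hk.elim x) (fun x => hk.elim x)
  rwa [← i.map_rel, ← j.map_rel, Subsingleton.elim (i ∘ _) v, Subsingleton.elim (j ∘ _) w] at this

/-- A countable structure with the extension property is universal. -/
theorem ExtensionProperty.exists_embedding [L.IsRelational] {C : Set (Bundled.{0} L.Structure)}
    (hC : IsFraisseClass C) {T : Type*} [L.Structure T] {M N : Type} [L.Structure M]
    [L.Structure N] [Countable M] [Countable N] (m : M →[L] T) {n : N → T} (hM : AgeIn C M)
    (hN : AgeIn C N) (hn : ExtensionProperty C T N n) : Nonempty (M ↪[L] N) := by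
  obtain ⟨h, -⟩ := IsPartialIso.exists_embedding (L := L) (m := m) (n := n) (f₀ := ∅) ∅
    (fun f hf a => hn.forth hM m hf a) (fun f hf b hb => hb.elim)
    ⟨by simp, fun R w hw => AgeIn.relMap_iff_of_isEmpty hC hM hN
      ⟨fun i => Finset.notMem_empty _ (hw i)⟩ R _ _, by simp⟩
  exact ⟨h⟩

/-! ### The generic structure over `T` -/

/-- A finite approximation to the generic structure: a member of `C` on a finite subset of
`ℕ × T`, mapped homomorphically to `T` by the second projection. -/
structure Approx [L.IsRelational] (C : Set (Bundled.{0} L.Structure)) (T : Type)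
    [L.Structure T] where
  carrier : Finset (ℕ × T)
  rel : ∀ {n}, L.Relations n → (Fin n → ℕ × T) → Prop
  mem : bundledOfRel (L := L) (X := {x // x ∈ carrier}) (fun R v => rel R fun i => (v i).1) ∈ C
  hom : ∀ {n} (R : L.Relations n) (v : Fin n → ℕ × T), (∀ i, v i ∈ carrier) → rel R v →
    Structure.RelMap R (Prod.snd ∘ v)

namespace Approx

variable [L.IsRelational] {C : Set (Bundled.{0} L.Structure)} {T : Type} [L.Structure T]

/-- The structure carried by an approximation. -/
def toBundled (p : Approx C T) : Bundled.{0} L.Structure :=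
  bundledOfRel (X := {x // x ∈ p.carrier}) fun R v => p.rel R fun i => (v i).1

theorem toBundled_mem (p : Approx C T) : p.toBundled ∈ C :=
  p.mem

instance : Preorder (Approx C T) where
  le p q := p.carrier ⊆ q.carrier ∧ ∀ {n} (R : L.Relations n) (v : Fin n → ℕ × T),
    (∀ i, v i ∈ p.carrier) → (p.rel R v ↔ q.rel R v)
  le_refl p := ⟨subset_rfl, fun _ _ _ => Iff.rfl⟩
  le_trans p q r hpq hqr := ⟨hpq.1.trans hqr.1, fun R v hv =>
    (hpq.2 R v hv).trans (hqr.2 R v fun i => hpq.1 (hv i))⟩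

/-- The map `e` is an embedding of the structure `X` into the approximation `p`, compatible with
the colouring `b` of `X`. -/
structure IsEmb (p : Approx C T) {X : Type} [L.Structure X] (b : X → T) (e : X → ℕ × T) :
    Prop where
  inj : Function.Injective e
  mem : ∀ x, e x ∈ p.carrier
  rel : ∀ {n} (R : L.Relations n) (v : Fin n → X), p.rel R (e ∘ v) ↔ Structure.RelMap R v
  col : ∀ x, (e x).2 = b x

theorem IsEmb.mono {p q : Approx C T} (hpq : p ≤ q) {X : Type} [L.Structure X] {b : X → T}
    {e : X → ℕ × T} (h : p.IsEmb b e) : q.IsEmb b e :=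
  ⟨h.inj, fun x => hpq.1 (h.mem x),
    fun R v => (hpq.2 R _ fun i => h.mem (v i)).symm.trans (h.rel R v), h.col⟩

/-- Approximations can be extended so as to realise a given extension of a substructure. -/
theorem exists_extension {U : Set (Bundled.{0} L.Structure)} (hU : IsStrictFraisse U)
    (hC : IsFraisseClass C) (hfree : IsFreeIn C U) [Countable T] (hT : AgeIn U T)
    (p : Approx C T) {A B : Bundled.{0} L.Structure} (hB : B ∈ C) (f : A ↪[L] B)
    (b : B →[L] T) {e : A → ℕ × T} (he : p.IsEmb (fun x => b (f x)) e) :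
    ∃ q, p ≤ q ∧ ∃ g : B → ℕ × T, q.IsEmb b g ∧ ∀ x, g (f x) = e x := by
  classical
  have := hC.finite B hB
  have hA : A ∈ C := hC.hereditary B hB A (Finite.of_injective f f.injective) ⟨f⟩
  let i : A ↪[L] p.toBundled := mkEmbedding (N := p.toBundled) (fun x => ⟨e x, he.mem x⟩)
    (fun x y h => he.inj (congrArg Subtype.val h)) he.rel
  let c : p.toBundled →[L] T := mkHom (M := p.toBundled) (fun x => x.1.2)
    fun R v h => p.hom R (fun i => (v i).1) (fun i => (v i).2) h
  obtain ⟨D, hD, g₁, g₂, d, hg, hd₁, hd₂⟩ := exists_amalgam_over hU hfree hT hA p.toBundled_mem hB i f c b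
    he.col
  have := hC.finite D hD
  -- An injection of the amalgam into `ℕ × T` that is compatible with colours and extends the
  -- inclusion of `p`.
  obtain ⟨j, hj, hjc, hjp⟩ : ∃ j : D → ℕ × T, Function.Injective j ∧ (∀ x, (j x).2 = d x) ∧
      ∀ y : {x // x ∈ p.carrier}, j (g₁ y) = y.1 := by
    have : Infinite {k // k ∉ p.carrier.image Prod.fst} :=
      (Finset.finite_toSet (p.carrier.image Prod.fst)).infinite_compl.to_subtype
    obtain ⟨t⟩ : Nonempty (D ↪ {k // k ∉ p.carrier.image Prod.fst}) := by
      obtain ⟨n, ⟨s⟩⟩ := Finite.exists_equiv_fin D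
      exact ⟨s.toEmbedding.trans (Fin.valEmbedding.trans (Infinite.natEmbedding _))⟩
    have ht : ∀ (x : D) (y : {x // x ∈ p.carrier}), ((t x).1, d x) ≠ y.1 := fun x y h =>
      (t x).2 (Finset.mem_image.2 ⟨y.1, y.2, by rw [← h]⟩)
    let j : D → ℕ × T := fun x => if h : ∃ y : {x // x ∈ p.carrier}, g₁ y = x then h.choose.1
      else ((t x).1, d x)
    have hj₁ : ∀ y : {x // x ∈ p.carrier}, j (g₁ y) = y.1 := fun y => by
      have h : ∃ z : {x // x ∈ p.carrier}, g₁ z = g₁ y := ⟨y, rfl⟩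
      have h' : h.choose = y := g₁.injective h.choose_spec
      change dite _ _ _ = _
      rw [dif_pos h, h']
    have hj₂ : ∀ x, (¬ ∃ y : {x // x ∈ p.carrier}, g₁ y = x) → j x = ((t x).1, d x) :=
      fun x h => dif_neg h
    refine ⟨j, fun x y hxy => ?_, fun x => ?_, hj₁⟩
    · by_cases hx : ∃ z : {x // x ∈ p.carrier}, g₁ z = x <;>
        by_cases hy : ∃ z : {x // x ∈ p.carrier}, g₁ z = y
      · obtain ⟨z, rfl⟩ := hx
        obtain ⟨w, rfl⟩ := hy
        rw [hj₁, hj₁] at hxy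
        rw [Subtype.ext hxy]
      · obtain ⟨z, rfl⟩ := hx
        rw [hj₁, hj₂ y hy] at hxy
        exact (ht y z hxy.symm).elim
      · obtain ⟨w, rfl⟩ := hy
        rw [hj₁, hj₂ x hx] at hxy
        exact (ht x w hxy).elim
      · rw [hj₂ x hx, hj₂ y hy] at hxy
        exact t.injective (Subtype.ext (congrArg Prod.fst hxy))
    · by_cases hx : ∃ z : {x // x ∈ p.carrier}, g₁ z = x
      · obtain ⟨z, rfl⟩ := hx
        rw [hj₁]
        exact (hd₁ z).symm
      · rw [hj₂ x hx]
  have := Fintype.ofFinite D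
  let r : ∀ {n}, L.Relations n → (Fin n → ℕ × T) → Prop :=
    fun R v => ∃ w, j ∘ w = v ∧ Structure.RelMap R w
  have hr : ∀ {n} (R : L.Relations n) (w : Fin n → D), r R (j ∘ w) ↔ Structure.RelMap R w :=
    fun R w => ⟨fun ⟨w', h, h'⟩ => by rwa [hj.comp_left h] at h', fun h => ⟨w, rfl, h⟩⟩
  have hlift : ∀ {n} (v : Fin n → ℕ × T), (∀ i, v i ∈ Finset.univ.image j) → ∃ w, j ∘ w = v :=
    fun v hv => by
      choose w _ hw using fun i => Finset.mem_image.1 (hv i)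
      exact ⟨w, funext hw⟩
  let q : Approx C T :=
    { carrier := Finset.univ.image j
      rel := r
      mem := by
        let Q : Bundled.{0} L.Structure :=
          bundledOfRel (X := {x // x ∈ Finset.univ.image j}) fun R v => r R fun i => (v i).1
        have hmem : ∀ x, j x ∈ Finset.univ.image j := fun x =>
          Finset.mem_image_of_mem _ (Finset.mem_univ x)
        let E : D ≃ Q := Equiv.ofBijective (fun x => ⟨j x, hmem x⟩)
          ⟨fun x y h => hj (congrArg Subtype.val h), fun y => by
            obtain ⟨x, -, hx⟩ := Finset.mem_image.1 y.2
            exact ⟨x, Subtype.ext hx⟩⟩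
        exact (hC.isoInvariant D Q
          ⟨⟨E, fun g => isEmptyElim g, fun R w => hr R w⟩⟩).1 hD
      hom := fun R v hv ⟨w, hw, h⟩ => by
        subst hw
        have := d.map_rel R w h
        rwa [show d ∘ w = Prod.snd ∘ j ∘ w from funext fun i => (hjc (w i)).symm] at this }
  refine ⟨q, ⟨fun x hx => ?_, fun R v hv => ?_⟩, fun x => j (g₂ x), ⟨?_, ?_, ?_, ?_⟩, fun x => ?_⟩
  · exact Finset.mem_image.2 ⟨g₁ (⟨x, hx⟩ : {x // x ∈ p.carrier}), Finset.mem_univ _, hjp ⟨x, hx⟩⟩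
  · let w : Fin _ → p.toBundled := fun i => ⟨v i, hv i⟩
    have hw : j ∘ g₁ ∘ w = v := funext fun i => hjp ⟨v i, hv i⟩
    have := hr R (g₁ ∘ w)
    rw [hw, g₁.map_rel] at this
    exact this.symm
  · exact hj.comp g₂.injective
  · exact fun x => Finset.mem_image_of_mem _ (Finset.mem_univ _)
  · exact fun R v => (hr R (g₂ ∘ v)).trans (g₂.map_rel R v)
  · exact fun x => (hjc _).trans (hd₂ x)
  · change j (g₂ (f x)) = e x
    rw [← hg]
    exact hjp ⟨e x, he.mem x⟩

/-- The empty approximation exists because the members of a strict Fraïssé class agree on nullary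
relations. -/
theorem nonempty {U : Set (Bundled.{0} L.Structure)} (hU : IsFraisseClass U)
    (hC : IsFraisseClass C) (hCU : C ⊆ U) (hT : AgeIn U T) : Nonempty (Approx C T) := by
  obtain ⟨B, hB⟩ := hC.nonempty
  have hBU : AgeIn U B := fun A hA h => hU.hereditary B (hCU hB) A hA h
  refine ⟨⟨∅, fun R v => Structure.RelMap R (Prod.snd ∘ v), ?_, fun R v _ h => h⟩⟩
  let Q : Bundled.{0} L.Structure :=
    bundledOfRel (X := {x // x ∈ (∅ : Finset (ℕ × T))})
      fun R v => Structure.RelMap R fun i => (v i).1.2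
  have hne : ∀ x : Q, False := fun x => Finset.notMem_empty _ x.2
  exact hC.hereditary B hB Q (inferInstanceAs (Finite {x // x ∈ (∅ : Finset (ℕ × T))}))
    ⟨mkEmbedding (M := Q) (fun x => (hne x).elim) (fun x => (hne x).elim) fun R v =>
      AgeIn.relMap_iff_of_isEmpty hU hBU hT ⟨fun i => hne (v i)⟩ R _ _⟩

end Approx

/-- There is a countable structure over `T` with age in `C` that has the extension property. -/
theorem exists_extensionProperty [L.IsRelational] {U C : Set (Bundled.{0} L.Structure)}
    (hU : IsStrictFraisse U) (hC : IsFraisseClass C) (hfree : IsFreeIn C U)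
    {T : Type} [L.Structure T] [Countable T] (hT : AgeIn U T) :
    ∃ (M : Bundled.{0} L.Structure) (u : M →[L] T), InBar C M ∧ ExtensionProperty C T M u := by
  classical
  obtain ⟨p₀⟩ := Approx.nonempty hU.1 hC hfree.1 hT
  obtain ⟨S, hS, hSC⟩ := hC.countableTypes
  let S' := {B : Bundled.{0} L.Structure // B ∈ S ∩ C}
  have : Countable S' := (hS.mono Set.inter_subset_left).to_subtype
  have hfin : ∀ B : S', Finite B.1 := fun B => hC.finite _ B.2.2
  let ι := Σ (B : S') (A : Set B.1), (B.1 → T) × (A → ℕ × T)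
  let realises : ι → Approx C T → Prop := fun t p =>
    ∃ g : t.1.1 → ℕ × T, p.IsEmb t.2.2.1 g ∧ ∀ x : t.2.1, g x = t.2.2.2 x
  let embeds : ι → Approx C T → Prop := fun t p =>
    letI := pull (L := L) (Subtype.val : t.2.1 → t.1.1)
    p.IsEmb (fun x : t.2.1 => t.2.2.1 x) t.2.2.2
  have hext : ∀ (t : ι) (p : Approx C T),
      (∀ {n} (R : L.Relations n) v, Structure.RelMap R v → Structure.RelMap R (t.2.2.1 ∘ v)) →
      embeds t p → ∃ q, p ≤ q ∧ realises t q := fun t p ht hp => by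
    obtain ⟨q, hpq, g, hg, hg'⟩ := p.exists_extension hU hC hfree hT t.1.2.2
      (inducedEmbedding (Subtype.val : t.2.1 → t.1.1) Subtype.val_injective)
      (mkHom t.2.2.1 ht) (e := t.2.2.2) hp
    exact ⟨q, hpq, g, hg, hg'⟩
  let 𝒟 : ι → Order.Cofinal (Approx C T) := fun t =>
    ⟨{p | (∀ {n} (R : L.Relations n) v,
        Structure.RelMap R v → Structure.RelMap R (t.2.2.1 ∘ v)) →
          realises t p ∨ ∀ q, p ≤ q → ¬ embeds t q}, fun p => by
      by_cases h : (∀ {n} (R : L.Relations n) v,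
        Structure.RelMap R v → Structure.RelMap R (t.2.2.1 ∘ v)) ∧ ∃ q, p ≤ q ∧ embeds t q
      · obtain ⟨ht, q, hpq, hq⟩ := h
        obtain ⟨q', hqq', hq'⟩ := hext t q ht hq
        exact ⟨q', fun _ => .inl hq', hpq.trans hqq'⟩
      · exact ⟨p, fun ht => .inr fun q hpq hq => h ⟨ht, q, hpq, hq⟩, le_rfl⟩⟩
  have := Encodable.ofCountable ι
  let I := Order.idealOfCofinals p₀ 𝒟
  have hmeet := Order.cofinal_meets_idealOfCofinals p₀ 𝒟
  let r : ∀ {n}, L.Relations n → (Fin n → ℕ × T) → Prop :=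
    fun R v => ∃ p ∈ I, (∀ i, v i ∈ p.carrier) ∧ p.rel R v
  have hr : ∀ p ∈ I, ∀ {n} (R : L.Relations n) (v : Fin n → ℕ × T), (∀ i, v i ∈ p.carrier) →
      (p.rel R v ↔ r R v) := fun p hp n R v hv => by
    refine ⟨fun h => ⟨p, hp, hv, h⟩, fun ⟨q, hq, hvq, h⟩ => ?_⟩
    obtain ⟨k, -, hpk, hqk⟩ := I.directed p hp q hq
    exact (hpk.2 R v hv).2 ((hqk.2 R v hvq).1 h)
  let s : Set (ℕ × T) := {x | ∃ p ∈ I, x ∈ p.carrier}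
  have hs : ∀ F : Set (ℕ × T), F.Finite → F ⊆ s → ∃ p ∈ I, F ⊆ p.carrier := fun F hF => by
    induction F, hF using Set.Finite.induction_on with
    | empty => exact fun _ => ⟨p₀, Order.mem_idealOfCofinals p₀ 𝒟, Set.empty_subset _⟩
    | insert _ _ ih =>
      intro h
      obtain ⟨p, hp, hFp⟩ := ih ((Set.subset_insert _ _).trans h)
      obtain ⟨q, hq, hxq⟩ := h (Set.mem_insert _ _)
      obtain ⟨k, hk, hpk, hqk⟩ := I.directed p hp q hq
      exact ⟨k, hk, Set.insert_subset (hqk.1 hxq) (hFp.trans hpk.1)⟩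
  have hsrange : ∀ {X : Type} [Finite X] (e : X → s), ∃ p ∈ I, ∀ x, (e x).1 ∈ p.carrier :=
    fun e => by
      obtain ⟨p, hp, h⟩ := hs (Set.range fun x => (e x).1) (Set.finite_range _)
        (Set.range_subset_iff.2 fun x => (e x).2)
      exact ⟨p, hp, fun x => h ⟨x, rfl⟩⟩
  let M : Bundled.{0} L.Structure := bundledOfRel (X := s) fun R v => r R fun i => (v i).1
  let u : M →[L] T := mkHom (M := M) (fun x => x.1.2) fun R v ⟨p, _, hv, h⟩ => p.hom R _ hv h
  refine ⟨M, u, ⟨inferInstanceAs (Countable s), fun A hA ⟨i⟩ => ?_⟩, ?_⟩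
  · obtain ⟨p, hp, hip⟩ := hsrange (X := A) i
    exact hC.hereditary p.toBundled p.toBundled_mem A hA ⟨mkEmbedding (N := p.toBundled)
      (fun x => ⟨(i x).1, hip x⟩)
      (fun x y h => by
        have h' : (i x).1 = (i y).1 := congrArg (fun z : {z // z ∈ p.carrier} => z.1) h
        exact i.injective (Subtype.ext h'))
      fun R v => (hr p hp R (fun k => (i (v k)).1) fun k => hip (v k)).trans (i.map_rel R v)⟩
  · intro A B hB f b e he
    obtain ⟨B', hB'S, ⟨σ⟩⟩ := hSC B hB
    have hB' : B' ∈ C := (hC.isoInvariant B B' ⟨σ⟩).1 hB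
    have hfB : Finite B := hC.finite B hB
    have hfA : Finite A := Finite.of_injective f f.injective
    have hσf : Function.Injective fun x => σ (f x) := σ.injective.comp f.injective
    let ρ : A ≃ Set.range fun x => σ (f x) := Equiv.ofInjective _ hσf
    have hρ : ∀ y, σ (f (ρ.symm y)) = y.1 := fun y => congrArg Subtype.val (ρ.apply_symm_apply y)
    let b' : B' →[L] T := b.comp σ.symm.toHom
    let t : ι := ⟨⟨B', hB'S, hB'⟩, Set.range fun x => σ (f x), b', fun y => (e (ρ.symm y)).1⟩
    obtain ⟨p, hp, hep⟩ := hsrange (X := A) e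
    have hemb : embeds t p := by
      let _ := pull (L := L) (Subtype.val : t.2.1 → t.1.1)
      refine ⟨fun x y h => ρ.symm.injective (e.injective (Subtype.ext h)), fun x => hep _,
        fun R v => ?_, fun y => ?_⟩
      · refine (hr p hp R _ fun i => hep _).trans ?_
        refine (e.map_rel R (ρ.symm ∘ v)).trans ?_
        rw [← f.map_rel, ← σ.map_rel]
        have : σ ∘ f ∘ ρ.symm ∘ v = Subtype.val ∘ v := funext fun i => hρ (v i)
        rw [this]
        rfl
      · change u (e (ρ.symm y)) = b (σ.symm y.1)
        rw [he, ← hρ y, σ.symm_apply_apply]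
    obtain ⟨q, hq, hqI⟩ := hmeet t
    obtain ⟨k, hk, hpk, hqk⟩ := I.directed p hp q hqI
    obtain ⟨g, hg, hge⟩ | h := hq fun R v h => b'.map_rel R v h
    · refine ⟨mkEmbedding (N := M) (fun x => ⟨g (σ x), q, hqI, hg.mem _⟩) (fun x y h => ?_)
        fun R v => ?_, fun x => ?_, fun x => ?_⟩
      · exact σ.injective (hg.inj (congrArg Subtype.val h))
      · refine (hr q hqI R (g ∘ σ ∘ v) fun i => hg.mem _).symm.trans ((hg.rel R _).trans ?_)
        exact σ.map_rel R v
      · have := hge (ρ x)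
        refine Subtype.ext (this.trans ?_)
        change (e (ρ.symm (ρ x))).1 = _
        rw [ρ.symm_apply_apply]
      · refine (hg.col _).trans ?_
        change b (σ.symm (σ x)) = _
        rw [σ.symm_apply_apply]
    · let _ := pull (L := L) (Subtype.val : t.2.1 → t.1.1)
      exact (h k hqk (Approx.IsEmb.mono (X := t.2.1) hpk hemb)).elim

/-! ### Oligomorphy -/

/-- Finite structures have oligomorphic automorphism groups. -/
theorem AutOligomorphic.of_finite_or {M : Type*} [L.Structure M]
    (h : Finite M ∨ AutOligomorphic L M) : AutOligomorphic L M := by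
  obtain h | h := h
  · exact fun n => ⟨Set.univ, Set.finite_univ, fun x => ⟨x, trivial, .refl L M, rfl⟩⟩
  · exact h

/-- The extension property is preserved when the colouring is composed with an automorphism. -/
theorem ExtensionProperty.comp_equiv {C : Set (Bundled.{0} L.Structure)}
    {T M : Type*} [L.Structure T] [L.Structure M] {u : M → T} (h : ExtensionProperty C T M u)
    (τ : T ≃[L] T) : ExtensionProperty C T M fun x => τ (u x) := by
  intro A B hB f b e he
  obtain ⟨g, hg, hgc⟩ := h A B hB f (τ.symm.toHom.comp b) e fun x => by
    change u (e x) = τ.symm (b (f x))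
    rw [← he, τ.symm_apply_apply]
  refine ⟨g, hg, fun x => ?_⟩
  change τ (u (g x)) = b x
  rw [hgc]
  exact τ.apply_symm_apply _

/-- A countable structure with the extension property has an oligomorphic automorphism group as
soon as both `T` and the Fraïssé limit of `C` do. -/
theorem ExtensionProperty.autOligomorphic [L.IsRelational] {C : Set (Bundled.{0} L.Structure)}
    {T : Type*} [L.Structure T] {M : Bundled.{0} L.Structure} {u : M →[L] T} (hM : InBar C M)
    (hu : ExtensionProperty C T M u) (hT : AutOligomorphic L T) {F : Bundled.{0} L.Structure}
    (hF : ∀ A : Bundled.{0} L.Structure, Finite A → A ∈ C → Nonempty (A ↪[L] F))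
    (hFo : AutOligomorphic L F) : AutOligomorphic L M := by
  classical
  have := hM.1
  intro n
  obtain ⟨SF, hSF, hF'⟩ := hFo n
  obtain ⟨ST, hST, hT'⟩ := hT n
  have hrep : ∀ x : Fin n → M, ∃ y ∈ SF, (∀ i j, x i = x j ↔ y i = y j) ∧
      ∀ {k} (R : L.Relations k) (w : Fin k → Fin n),
        Structure.RelMap R (x ∘ w) ↔ Structure.RelMap R (y ∘ w) := fun x => by
    let A : Bundled.{0} L.Structure := induced (Subtype.val : Set.range x → M)
    have hA : Finite A := inferInstanceAs (Finite (Set.range x))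
    let i : A ↪[L] M := inducedEmbedding _ Subtype.val_injective
    obtain ⟨j⟩ := hF A hA (hM.2 A hA ⟨i⟩)
    let x' : Fin n → A := fun k => ⟨x k, k, rfl⟩
    obtain ⟨y, hy, g, hg⟩ := hF' (j ∘ x')
    refine ⟨y, hy, fun k l => ?_, fun R w => ?_⟩
    · rw [← g.injective.eq_iff (a := y k)]
      have h := fun k => congrFun hg k
      simp only [Function.comp_apply] at h
      rw [h, h, j.injective.eq_iff]
      exact (Subtype.ext_iff (a1 := x' k) (a2 := x' l)).symm
    · rw [← g.map_rel R (y ∘ w), ← Function.comp_assoc, hg, Function.comp_assoc, j.map_rel]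
      rfl
  choose yF hyF hinj hrel using hrep
  choose t ht τ hτ using fun x : Fin n → M => hT' (u ∘ x)
  let c : (Fin n → M) → (Fin n → F) × (Fin n → T) := fun x => (yF x, t x)
  have hc : (Set.range c).Finite := (hSF.prod hST).subset
    (Set.range_subset_iff.2 fun x => ⟨hyF x, ht x⟩)
  have := hc.to_subtype
  refine ⟨Set.range (Set.rangeSplitting c), Set.finite_range _, fun x => ?_⟩
  let y := Set.rangeSplitting c ⟨c x, x, rfl⟩
  have hy : c y = c x := Set.apply_rangeSplitting c _
  have hy₁ : yF y = yF x := congrArg Prod.fst hy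
  have hy₂ : t y = t x := congrArg Prod.snd hy
  let θ : T ≃[L] T := (τ x).comp (τ y).symm
  have hθ : ∀ i, θ (u (y i)) = u (x i) := fun i => by
    have h₁ : τ y (t y i) = u (y i) := congrFun (hτ y) i
    have h₂ : τ x (t x i) = u (x i) := congrFun (hτ x) i
    change τ x ((τ y).symm (u (y i))) = _
    rw [← h₁, (τ y).symm_apply_apply, hy₂, h₂]
  obtain ⟨h, hh⟩ := (hu.comp_equiv θ).exists_equiv (θ.toHom.comp u) u hM.2 hM.2 hu
    (f := Finset.univ.image fun i => (y i, x i)) (by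
      refine ⟨fun p hp q hq => ?_, fun R w hw => ?_, fun p hp => ?_⟩
      · obtain ⟨i, -, rfl⟩ := Finset.mem_image.1 hp
        obtain ⟨j, -, rfl⟩ := Finset.mem_image.1 hq
        rw [hinj y, hinj x, hy₁]
      · choose i _ hi using fun k => Finset.mem_image.1 (hw k)
        have hw' : w = fun k => (y (i k), x (i k)) := funext fun k => (hi k).symm
        subst hw'
        have := hrel y R i
        rw [hy₁] at this
        exact this.trans (hrel x R i).symm
      · obtain ⟨i, -, rfl⟩ := Finset.mem_image.1 hp
        exact hθ i)
  exact ⟨y, ⟨_, rfl⟩, h, funext fun i =>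
    hh _ (Finset.mem_image_of_mem (fun i => (y i, x i)) (Finset.mem_univ i))⟩

/-- In the setting of Theorem `univ-struc`, if the Fraïssé limit of `𝒞` is
finite or has an oligomorphic automorphism group, and `T` is finite or `Aut(T)` is
oligomorphic, then `𝒞̄ ∩ CSP(T)-bar` has a universal element whose automorphism group is
oligomorphic. -/
theorem exists_oligomorphic_universal_in_csp (L : FirstOrder.Language.{u, v}) [L.IsRelational]
    (U C : Set (Bundled.{0} L.Structure))
    (hU : IsStrictFraisse U) (hC : IsFraisseClass C) (hfree : IsFreeIn C U)
    (T : Type) [L.Structure T] [Countable T] (hT : AgeIn U T)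
    (hlim : ∃ F : Bundled.{0} L.Structure, IsFraisseLimitOf C F ∧
      (Finite F ∨ AutOligomorphic L F))
    (hTo : Finite T ∨ AutOligomorphic L T) :
    ∃ (Ub : Bundled.{0} L.Structure) (_u : Ub →[L] T), InBar C Ub ∧
      (∀ A : Bundled.{0} L.Structure, InBar C A → Nonempty (A →[L] T) →
        Nonempty (A ↪[L] Ub)) ∧
      AutOligomorphic L Ub := by
  obtain ⟨M, u, hM, hu⟩ := exists_extensionProperty hU hC hfree hT
  obtain ⟨F, ⟨-, hF, -⟩, hFo⟩ := hlim
  have := hM.1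
  refine ⟨M, u, hM, fun A hA ⟨a⟩ => ?_, ?_⟩
  · have := hA.1
    exact hu.exists_embedding hC a hA.2 hM.2
  · exact hu.autOligomorphic hM (.of_finite_or hTo) (fun A hA h => (hF A hA).1 h) (.of_finite_or hFo)

end Stmt4
end

section
/- Let T be a countable weakly oligomorphic structure over a finite relational signature. Then there exists a countable structure U that is homomorphism-equivalent to T, whose automorphism group Aut(U) is oligomorphic, and such that every countable structure that is homomorphism-equivalent to T embeds into U. -/
open FirstOrder Language CategoryTheory

universe u v

namespace Stmt6

/-- A relation invariant under all endomorphisms of `M`. -/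
def EndInvariant (L : FirstOrder.Language.{u, v}) (M : Type*) [L.Structure M] {n : ℕ}
    (ρ : Set (Fin n → M)) : Prop :=
  ∀ f : M →[L] M, ∀ x ∈ ρ, (⇑f ∘ x) ∈ ρ

/-- A structure is weakly oligomorphic if for every arity there are only finitely many
relations invariant under its endomorphism monoid. -/
def WeaklyOligomorphic (L : FirstOrder.Language.{u, v}) (M : Type*) [L.Structure M] : Prop :=
  ∀ n : ℕ, {ρ : Set (Fin n → M) | EndInvariant L M ρ}.Finite

/-- The automorphism group of `M` is oligomorphic: for every `n` there are only finitely
many orbits on `n`-tuples. -/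
def AutOligomorphic (L : FirstOrder.Language.{u, v}) (M : Type*) [L.Structure M] : Prop :=
  ∀ n : ℕ, ∃ S : Set (Fin n → M), S.Finite ∧
    ∀ x : Fin n → M, ∃ y ∈ S, ∃ g : M ≃[L] M, ⇑g ∘ y = x

open Structure

section Recurrence

variable {L : FirstOrder.Language.{u, v}} {T : Type} [L.Structure T] {X : Type}

variable (L) in
/-- The family `v` is recurrent on `F` if every endomorphic image of `v '' F` can be mapped back
pointwise by an endomorphism. -/
def RecurrentOn (F : Set X) (v : X → T) : Prop :=
  ∀ f : T →[L] T, ∃ g : T →[L] T, ∀ x ∈ F, g (f (v x)) = v x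

theorem RecurrentOn.comp_hom {F : Set X} {v : X → T} (h : RecurrentOn L F v) (k : T →[L] T) :
    RecurrentOn L F (fun x => k (v x)) := by
  intro f
  obtain ⟨g, hg⟩ := h (f.comp k)
  exact ⟨k.comp g, fun x hx => congrArg k (hg x hx)⟩

theorem RecurrentOn.mono {F G : Set X} {v : X → T} (h : RecurrentOn L G v) (hFG : F ⊆ G) :
    RecurrentOn L F v := fun f =>
  (h f).imp fun _ hg x hx => hg x (hFG hx)

theorem RecurrentOn.congr {F : Set X} {v w : X → T} (h : RecurrentOn L F v)
    (hvw : ∀ x ∈ F, w x = v x) : RecurrentOn L F w := fun f =>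
  (h f).imp fun _ hg x hx => by rw [hvw x hx, hg x hx]

/-- Every finite family in a weakly oligomorphic structure has a recurrent endomorphic image. -/
theorem WeaklyOligomorphic.exists_recurrentOn (hT : WeaklyOligomorphic L T) {F : Set X}
    (hF : F.Finite) (v : X → T) : ∃ c : T →[L] T, RecurrentOn L F (fun x => c (v x)) := by
  obtain ⟨n, p, rfl⟩ : ∃ (n : ℕ) (p : Fin n → X), Set.range p = F := by
    obtain ⟨n, p, -, hp⟩ := hF.fin_param
    exact ⟨n, p, hp⟩
  let up (f : T →[L] T) : Set (Fin n → T) := {y | ∃ k : T →[L] T, ∀ i, k (f (v (p i))) = y i}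
  have hfin : (Set.range up).Finite := by
    refine (hT n).subset ?_
    rintro _ ⟨f, rfl⟩ e y ⟨k, hk⟩
    exact ⟨e.comp k, fun i => congrArg e (hk i)⟩
  obtain ⟨_, ⟨c, rfl⟩, hc⟩ := hfin.exists_minimal ⟨_, Hom.id L T, rfl⟩
  refine ⟨c, fun f => ?_⟩
  have hle : up (f.comp c) ≤ up c := by
    rintro y ⟨k, hk⟩
    exact ⟨k.comp f, hk⟩
  obtain ⟨g, hg⟩ := hc ⟨f.comp c, rfl⟩ hle (show (fun i => c (v (p i))) ∈ up c from
    ⟨Hom.id L T, fun _ => rfl⟩)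
  refine ⟨g, ?_⟩
  rintro _ ⟨i, rfl⟩
  exact hg i

/-- An inverse sequence of families, coherent up to endomorphisms, has a limit. -/
theorem exists_limit (F : ℕ → Set X) (hF : Monotone F) (hcov : ∀ x, ∃ n, x ∈ F n)
    (v : ℕ → X → T) (hv : ∀ n, ∃ f : T →[L] T, ∀ x ∈ F n, f (v (n + 1) x) = v n x) :
    ∃ h : X → T, ∀ n, ∃ a : T →[L] T, ∀ x ∈ F n, h x = a (v n x) := by
  choose f hf using hv
  choose N hN using hcov
  let a : ℕ → (T →[L] T) := fun n => Nat.rec (Hom.id L T) (fun n b => b.comp (f n)) n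
  have key : ∀ n m, n ≤ m → ∀ x ∈ F n, a m (v m x) = a n (v n x) := by
    intro n m hnm x hx
    induction m, hnm using Nat.le_induction with
    | base => rfl
    | succ m hnm ih =>
      rw [← ih]
      exact congrArg (a m) (hf m x (hF hnm hx))
  refine ⟨fun x => a (N x) (v (N x) x), fun n => ⟨a n, fun x hx => ?_⟩⟩
  rcases le_total (N x) n with h | h
  · exact (key _ _ h x (hN x)).symm
  · exact key _ _ h x hx

theorem exists_mem_of_monotone {ι : Type} [Finite ι] {F : ℕ → Set X} (hF : Monotone F)
    {x : ι → X} (hcov : ∀ i, ∃ n, x i ∈ F n) : ∃ n, ∀ i, x i ∈ F n := by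
  choose N hN using hcov
  obtain ⟨n, hn⟩ := Finite.exists_le N
  exact ⟨n, fun i => hF (hn i) (hN i)⟩

theorem exists_subset_of_monotone {F : ℕ → Set X} (hF : Monotone F) (hcov : ∀ x, ∃ n, x ∈ F n)
    {G : Set X} (hG : G.Finite) : ∃ n, G ⊆ F n := by
  have := hG.to_subtype
  obtain ⟨n, hn⟩ := exists_mem_of_monotone hF (x := fun i : G => i.1) fun i => hcov i
  exact ⟨n, fun x hx => hn ⟨x, hx⟩⟩

/-- A countable weakly oligomorphic structure has an endomorphism that is recurrent on all
finite sets. -/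
theorem WeaklyOligomorphic.exists_recurrent_hom [L.IsRelational] [Countable T]
    (hT : WeaklyOligomorphic L T) :
    ∃ e : T →[L] T, ∀ F : Set T, F.Finite → RecurrentOn L F e := by
  obtain ⟨enc, henc⟩ := Countable.exists_injective_nat T
  let F : ℕ → Set T := fun n => {t | enc t < n}
  have hFmono : Monotone F := fun m n hmn t ht => lt_of_lt_of_le ht hmn
  have hFcov : ∀ t, ∃ n, t ∈ F n := fun t => ⟨enc t + 1, Nat.lt_succ_self _⟩
  have hFfin : ∀ n, (F n).Finite := fun n => (Set.finite_Iio n).preimage henc.injOn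
  choose c hc using fun (n : ℕ) (f : T →[L] T) => hT.exists_recurrentOn (hFfin n) f
  let f : ℕ → (T →[L] T) :=
    fun n => Nat.rec (c 0 (Hom.id L T)) (fun n b => (c (n + 1) b).comp b) n
  have hf : ∀ n, RecurrentOn L (F n) (f n) := by
    rintro (_ | n)
    · exact hc 0 (Hom.id L T)
    · exact hc (n + 1) (f n)
  obtain ⟨h, hh⟩ := exists_limit F hFmono hFcov (fun n => f n)
    fun n => hf n (c (n + 1) (f n))
  refine ⟨⟨h, fun g => isEmptyElim g, fun {k} R x hx => ?_⟩, fun G hG => ?_⟩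
  · obtain ⟨n, hn⟩ := exists_mem_of_monotone hFmono fun i => hFcov (x i)
    obtain ⟨a, ha⟩ := hh n
    have : h ∘ x = a.comp (f n) ∘ x := funext fun i => ha _ (hn i)
    rw [this]
    exact (a.comp (f n)).map_rel R x hx
  · obtain ⟨n, hn⟩ := exists_subset_of_monotone hFmono hFcov hG
    obtain ⟨a, ha⟩ := hh n
    exact (((hf n).comp_hom a).congr ha).mono hn

variable (L) in
/-- A subset of `T` all of whose finite subsets are recurrent and over which every element of `T`
can be moved into the subset by an endomorphism fixing finitely many given points. -/
structure IsCoreSet (S : Set T) : Prop where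
  recurrent : ∀ F ⊆ S, F.Finite → RecurrentOn L F id
  exists_hom : ∀ F ⊆ S, F.Finite → ∀ t, ∃ k : T →[L] T, (∀ x ∈ F, k x = x) ∧ k t ∈ S

/-- The core set is the image of the direct limit of the iterates of a recurrent endomorphism. -/
theorem WeaklyOligomorphic.exists_isCoreSet [L.IsRelational] [Countable T]
    (hT : WeaklyOligomorphic L T) : ∃ S : Set T, IsCoreSet L S := by
  obtain ⟨e, he⟩ := hT.exists_recurrent_hom
  have hiter : ∀ n : ℕ, ∃ f : T →[L] T, ∀ t, f t = e^[n] t := by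
    intro n
    induction n with
    | zero => exact ⟨Hom.id L T, fun _ => rfl⟩
    | succ n ih =>
      obtain ⟨f, hf⟩ := ih
      exact ⟨e.comp f, fun t => by
        rw [Function.iterate_succ_apply', ← hf]; rfl⟩
  obtain ⟨enc, henc⟩ := Countable.exists_injective_nat (ℕ × T)
  let F : ℕ → Set (ℕ × T) := fun n => {p | p.1 < n ∧ enc p < n}
  have hFmono : Monotone F := fun m n hmn p hp =>
    ⟨lt_of_lt_of_le hp.1 hmn, lt_of_lt_of_le hp.2 hmn⟩
  have hFcov : ∀ p, ∃ n, p ∈ F n := fun p =>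
    ⟨max p.1 (enc p) + 1, by simp [F]⟩
  have hFfin : ∀ n, (F n).Finite := fun n =>
    ((Set.finite_Iio n).preimage henc.injOn).subset fun p hp => hp.2
  let v : ℕ → ℕ × T → T := fun n p => e^[n - p.1] p.2
  have hvadd : ∀ m n, m ≤ n → ∀ p : ℕ × T, p.1 ≤ m → v n p = e^[n - m] (v m p) := by
    intro m n hmn p hp
    simp only [v]
    rw [← Function.iterate_add_apply]
    congr 1
    omega
  have hvrec : ∀ n, RecurrentOn L (F n) (v n) := by
    intro n f
    obtain ⟨g, hg⟩ := he ((v (n - 1)) '' F n) ((hFfin n).image _) f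
    refine ⟨g, fun p hp => ?_⟩
    have h1 : v n p = e (v (n - 1) p) := by
      have hp1 := hp.1
      rw [hvadd (n - 1) n (by omega) p (by omega), show n - (n - 1) = 1 by omega]
      rfl
    rw [h1]
    exact hg _ ⟨p, hp, rfl⟩
  obtain ⟨h, hh⟩ := exists_limit F hFmono hFcov v fun n => by
    obtain ⟨g, hg⟩ := hvrec n e
    refine ⟨g, fun p hp => ?_⟩
    rw [hvadd n (n + 1) (by omega) p hp.1.le, Nat.add_sub_cancel_left]
    exact hg p hp
  have hlift : ∀ G ⊆ Set.range h, G.Finite → ∃ n, ∀ x ∈ G, ∃ p ∈ F n, h p = x := by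
    intro G hG hGfin
    have := hGfin.to_subtype
    choose p hp using fun x : G => hG x.2
    obtain ⟨n, hn⟩ := exists_mem_of_monotone hFmono fun x => hFcov (p x)
    exact ⟨n, fun x hx => ⟨p ⟨x, hx⟩, hn _, hp _⟩⟩
  refine ⟨Set.range h, fun G hG hGfin f => ?_, fun G hG hGfin t => ?_⟩
  · obtain ⟨n, hn⟩ := hlift G hG hGfin
    obtain ⟨a, ha⟩ := hh n
    obtain ⟨g, hg⟩ := (((hvrec n).comp_hom a).congr ha) f
    refine ⟨g, fun x hx => ?_⟩
    obtain ⟨p, hp, rfl⟩ := hn x hx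
    exact hg p hp
  · obtain ⟨n, hn⟩ := hlift G hG hGfin
    obtain ⟨a, ha⟩ := hh n
    obtain ⟨r, hr⟩ := hvrec n a
    obtain ⟨m, hnm, hm⟩ : ∃ m, n ≤ m ∧ (n, r t) ∈ F m := by
      obtain ⟨m, hm⟩ := hFcov (n, r t)
      exact ⟨max n m, le_max_left _ _, hFmono (le_max_right _ _) hm⟩
    obtain ⟨b, hb⟩ := hh m
    obtain ⟨i, hi⟩ := hiter (m - n)
    refine ⟨b.comp (i.comp r), fun x hx => ?_, (n, r t), ?_⟩
    · obtain ⟨p, hp, rfl⟩ := hn x hx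
      change b (i (r (h p))) = h p
      rw [ha p hp, hr p hp, hi, ← hvadd n m hnm p hp.1.le, ← hb p (hFmono hnm hp), ha p hp]
    · rw [hb _ hm]
      exact congrArg b (hi (r t)).symm

end Recurrence

section Generic

variable {L : FirstOrder.Language.{u, v}} {T : Type} [L.Structure T]

/-- A structure over `T` in which every one-point extension of a finite set, with all relations
permitted by the projection `w`, is realized over each point of `S`. -/
structure IsGenericOver {U : Type} [L.Structure U] (w : U →[L] T) (S : Set T) : Prop where
  mem : ∀ x, w x ∈ S
  nullary : ∀ (R : L.Relations 0) (x : Fin 0 → U), RelMap R (w ∘ x) → RelMap R x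
  exists_point : ∀ X : Set U, X.Finite → ∀ t ∈ S,
    ∀ Q : ∀ k, L.Relations k → (Fin k → Option X) → Prop,
    ∃ y ∉ X, w y = t ∧ ∀ (k : ℕ) (R : L.Relations k) (z : Fin k → Option X), (∃ i, z i = none) →
      (RelMap R (fun j => (z j).elim y Subtype.val) ↔
        Q k R z ∧ RelMap R (fun j => (z j).elim t fun x => w x))

theorem exists_isGenericOver [L.IsRelational] [Finite (Σ n, L.Relations n)] [Countable T]
    (S : Set T) : ∃ (U : Type) (_ : L.Structure U) (_ : Countable U) (w : U →[L] T),
      IsGenericOver w S := by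
  classical
  let U : Type := ℕ × S × Finset ℕ
  obtain ⟨enc, henc⟩ := Countable.exists_injective_nat U
  obtain ⟨code, hcode⟩ := Countable.exists_injective_nat
    (Σ r : (Σ n, L.Relations n), (Fin r.1 → Option ℕ))
  let inst : L.Structure U :=
    { funMap := fun f => isEmptyElim f
      RelMap := fun {k} R x => RelMap R (fun j => ((x j).2.1 : T)) ∧
        ∀ i, (∀ j, enc (x j) ≤ enc (x i)) →
          code ⟨⟨k, R⟩, fun j => if x j = x i then none else some (enc (x j))⟩ ∈ (x i).2.2 }
  let w : U →[L] T := ⟨fun x => x.2.1, fun f => isEmptyElim f, fun R x hx => hx.1⟩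
  refine ⟨U, inst, inferInstanceAs (Countable (ℕ × S × Finset ℕ)), w, fun x => x.2.1.2,
    fun R x hx => ⟨hx, fun i => i.elim0⟩, fun X hX t ht Q => ?_⟩
  have := hX.to_subtype
  let emb : (Σ r : (Σ n, L.Relations n), (Fin r.1 → Option X)) →
      (Σ r : (Σ n, L.Relations n), (Fin r.1 → Option ℕ)) :=
    Sigma.map id fun r z j => (z j).map fun x : X => enc x.1
  have hemb : Function.Injective emb :=
    Function.injective_id.sigma_map fun _ => Function.Injective.comp_left
      (Option.map_injective (henc.comp Subtype.val_injective))
  have hfin : ((code ∘ emb) '' {q | Q q.1.1 q.1.2 q.2}).Finite := (Set.toFinite _).image _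
  let D : Finset ℕ := hfin.toFinset
  have hD : ∀ k (R : L.Relations k) (z : Fin k → Option X),
      code ⟨⟨k, R⟩, fun j => (z j).map fun x : X => enc x.1⟩ ∈ D ↔ Q k R z := by
    intro k R z
    rw [hfin.mem_toFinset]
    exact (hcode.comp hemb).mem_set_image (a := ⟨⟨k, R⟩, z⟩)
  obtain ⟨B, hB⟩ : ∃ B, ∀ x : X, enc x ≤ B := Finite.exists_le _
  have hinf : (Set.range fun m : ℕ => enc (m, ⟨t, ht⟩, D)).Infinite :=
    Set.infinite_range_of_injective fun m n hmn => congrArg Prod.fst (henc hmn)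
  obtain ⟨_, ⟨m, rfl⟩, hm⟩ := hinf.exists_gt B
  let y : U := (m, ⟨t, ht⟩, D)
  have hlt : ∀ x ∈ X, enc x < enc y := fun x hx => (hB ⟨x, hx⟩).trans_lt hm
  have hyX : y ∉ X := fun h => lt_irrefl _ (hlt y h)
  refine ⟨y, hyX, rfl, fun k R z ⟨i₀, hi₀⟩ => ?_⟩
  set x : Fin k → U := fun j => (z j).elim y Subtype.val with hx
  have hxT : (fun j => ((x j).2.1 : T)) = fun j => (z j).elim t fun x => w x := by
    funext j
    simp only [hx]
    cases z j <;> rfl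
  have hcodes : (fun j => if x j = y then none else some (enc (x j))) =
      fun j => (z j).map fun x : X => enc x.1 := by
    funext j
    simp only [hx]
    cases hz : z j with
    | none => simp
    | some a =>
      have : (a : U) ≠ y := fun h => hyX (h ▸ a.2)
      simp [this]
  have hle : ∀ j, enc (x j) ≤ enc y := by
    intro j
    simp only [hx]
    cases z j with
    | none => exact le_rfl
    | some a => exact (hlt _ a.2).le
  have hi₀' : x i₀ = y := by simp [hx, hi₀]
  have hmax : ∀ i, (∀ j, enc (x j) ≤ enc (x i)) ↔ x i = y := fun i =>
    ⟨fun h => henc (le_antisymm (hle i) (hi₀' ▸ h i₀)), fun h => h ▸ hle⟩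
  change (RelMap R (fun j => ((x j).2.1 : T)) ∧ ∀ i, (∀ j, enc (x j) ≤ enc (x i)) →
    code ⟨⟨k, R⟩, fun j => if x j = x i then none else some (enc (x j))⟩ ∈ (x i).2.2) ↔ _
  rw [hxT, and_comm, ← hD, ← hcodes]
  refine and_congr_left fun _ => ⟨fun h => ?_, fun h i hi => ?_⟩
  · simpa only [hi₀'] using h i₀ ((hmax i₀).2 hi₀')
  · rw [(hmax i).1 hi]
    exact h

end Generic

section BackAndForth

variable {L : FirstOrder.Language.{u, v}} {T M N : Type} [L.Structure T] [L.Structure M]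
  [L.Structure N]

variable (L) in
/-- The graph of a partial isomorphism between `M` and `N`. -/
structure IsPartialIso (s : Set (M × N)) : Prop where
  eq_iff : ∀ p ∈ s, ∀ q ∈ s, p.1 = q.1 ↔ p.2 = q.2
  rel_iff : ∀ (k : ℕ) (R : L.Relations k) (z : Fin k → M × N), (∀ i, z i ∈ s) →
    (RelMap R (fun i => (z i).1) ↔ RelMap R (fun i => (z i).2))

/-- A partial isomorphism lifting an endomorphism of `T` along `w` and `w'`. -/
structure IsPartialLift (w : M →[L] T) (w' : N →[L] T) (s : Set (M × N)) : Prop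
    extends IsPartialIso L s where
  exists_hom : ∃ g : T →[L] T, ∀ p ∈ s, g (w p.1) = w' p.2

theorem IsPartialIso.swap {s : Set (M × N)} (hs : IsPartialIso L s) :
    IsPartialIso L (Prod.swap ⁻¹' s) where
  eq_iff _ hp _ hq := (hs.eq_iff _ hp _ hq).symm
  rel_iff k R z hz := (hs.rel_iff k R (fun i => (z i).swap) hz).symm

theorem IsPartialLift.swap {S : Set T} (hS : IsCoreSet L S) {w : M →[L] T} {w' : N →[L] T}
    (hw : ∀ x, w x ∈ S) {s : Set (M × N)} (hfin : s.Finite) (hs : IsPartialLift w w' s) :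
    IsPartialLift w' w (Prod.swap ⁻¹' s) where
  toIsPartialIso := hs.toIsPartialIso.swap
  exists_hom := by
    obtain ⟨g, hg⟩ := hs.exists_hom
    obtain ⟨r, hr⟩ := hS.recurrent ((fun p : M × N => w p.1) '' s)
      (by rintro _ ⟨p, -, rfl⟩; exact hw _) (hfin.image _) g
    refine ⟨r, fun p hp => ?_⟩
    rw [show w' p.1 = g (w p.2) from (hg _ hp).symm]
    exact hr _ ⟨p.swap, hp, rfl⟩

/-- The forth step into a generic structure over a core set. -/
theorem IsPartialLift.exists_insert {S : Set T} (hS : IsCoreSet L S) {w : M →[L] T}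
    {w' : N →[L] T} (hw' : IsGenericOver w' S) {s : Set (M × N)} (hfin : s.Finite)
    (hs : IsPartialLift w w' s) (a : M) : ∃ b, IsPartialLift w w' (insert (a, b) s) := by
  classical
  by_cases ha : ∃ p ∈ s, p.1 = a
  · obtain ⟨p, hp, rfl⟩ := ha
    exact ⟨p.2, by rwa [Set.insert_eq_of_mem hp]⟩
  push Not at ha
  obtain ⟨g, hg⟩ := hs.exists_hom
  obtain ⟨k, hk, hkS⟩ := hS.exists_hom ((fun p : M × N => w' p.2) '' s)
    (by rintro _ ⟨p, -, rfl⟩; exact hw'.mem _) (hfin.image _) (g (w a))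
  choose inv hinv using fun x : Prod.snd '' s => x.2
  obtain ⟨b, hb, hbt, hbR⟩ := hw'.exists_point (Prod.snd '' s) (hfin.image _) _ hkS
    fun _ R z => RelMap R fun j => (z j).elim a fun x => (inv x).1
  have hbs : ∀ p ∈ s, p.2 ≠ b := fun p hp h => hb ⟨p, hp, h⟩
  have hg' : ∀ p ∈ insert (a, b) s, k.comp g (w p.1) = w' p.2 := by
    rintro p (rfl | hp)
    · exact hbt.symm
    · change k (g (w p.1)) = w' p.2
      rw [hg p hp, hk _ ⟨p, hp, rfl⟩]
  refine ⟨b, ⟨⟨?_, fun n R z hz => ?_⟩, k.comp g, hg'⟩⟩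
  · rintro p (rfl | hp) q (rfl | hq)
    · simp
    · exact iff_of_false (ha q hq).symm (hbs q hq).symm
    · exact iff_of_false (ha p hp) (hbs p hp)
    · exact hs.eq_iff p hp q hq
  by_cases hzs : ∀ i, z i ∈ s
  · exact hs.rel_iff n R z hzs
  push Not at hzs
  obtain ⟨i₀, hi₀⟩ := hzs
  let z' : Fin n → Option (Prod.snd '' s) := fun j =>
    if h : z j ∈ s then some ⟨(z j).2, z j, h, rfl⟩ else none
  have hz₂ : ∀ j, (z j).2 = (z' j).elim b Subtype.val := by
    intro j
    by_cases h : z j ∈ s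
    · simp [z', h]
    · simp only [z', h, dite_false, Option.elim_none]
      exact congrArg Prod.snd ((hz j).resolve_right h)
  have hz₁ : ∀ j, (z j).1 = (z' j).elim a fun x => (inv x).1 := by
    intro j
    by_cases h : z j ∈ s
    · simp only [z', h, dif_pos, Option.elim_some]
      exact (hs.eq_iff _ h _ (hinv _).1).2 (hinv ⟨(z j).2, z j, h, rfl⟩).2.symm
    · simp only [z', h, dite_false, Option.elim_none]
      exact congrArg Prod.fst ((hz j).resolve_right h)
  have hzT : (fun j => (z' j).elim (k (g (w a))) fun x => w' x) =
      k.comp g ∘ w ∘ fun j => (z j).1 := by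
    funext j
    change _ = k.comp g (w (z j).1)
    rw [hg' _ (hz j), hz₂]
    cases z' j
    · exact hbt.symm
    · rfl
  have hR := hbR n R z' ⟨i₀, dif_neg hi₀⟩
  rw [hzT] at hR
  simp only [← hz₂, ← hz₁] at hR
  rw [hR]
  exact ⟨fun h => ⟨h, (k.comp g).map_rel R _ (w.map_rel R _ h)⟩, And.left⟩

/-- Finite sets with a property `P` extend to an increasing sequence meeting countably many
requirements. -/
theorem exists_chain {X ι : Type} [Countable ι] (P : Set X → Prop) (D : ι → Set X → Prop)
    (hD : ∀ i s, s.Finite → P s → ∃ s', s ⊆ s' ∧ s'.Finite ∧ P s' ∧ D i s')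
    (s₀ : Set X) (hfin : s₀.Finite) (h₀ : P s₀) :
    ∃ s : ℕ → Set X, Monotone s ∧ s₀ = s 0 ∧ (∀ n, P (s n)) ∧ ∀ i, ∃ n, D i (s n) := by
  have := Encodable.ofCountable ι
  let C : ι → Order.Cofinal {s : Set X // s.Finite ∧ P s} := fun i =>
    { carrier := {s | D i s.1}
      isCofinal := fun s => by
        obtain ⟨s', hss', hs'fin, hs'P, hs'D⟩ := hD i s.1 s.2.1 s.2.2
        exact ⟨⟨s', hs'fin, hs'P⟩, hs'D, hss'⟩ }
  let s := Order.sequenceOfCofinals ⟨s₀, hfin, h₀⟩ C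
  exact ⟨fun n => (s n).1, Order.sequenceOfCofinals.monotone _ C, rfl, fun n => (s n).2.2,
    fun i => ⟨_, Order.sequenceOfCofinals.encode_mem _ C i⟩⟩

theorem IsPartialIso.iUnion {s : ℕ → Set (M × N)} (hmono : Monotone s)
    (hs : ∀ n, IsPartialIso L (s n)) : IsPartialIso L (⋃ n, s n) where
  eq_iff p hp q hq := by
    obtain ⟨m, hm⟩ := Set.mem_iUnion.1 hp
    obtain ⟨n, hn⟩ := Set.mem_iUnion.1 hq
    exact (hs (max m n)).eq_iff p (hmono (le_max_left _ _) hm) q (hmono (le_max_right _ _) hn)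
  rel_iff k R z hz := by
    obtain ⟨n, hn⟩ := exists_mem_of_monotone hmono fun i => Set.mem_iUnion.1 (hz i)
    exact (hs n).rel_iff k R z hn

theorem IsPartialIso.exists_embedding [L.IsRelational] {s : Set (M × N)} (hs : IsPartialIso L s)
    (hdom : ∀ a, ∃ b, (a, b) ∈ s) : ∃ f : M ↪[L] N, ∀ a, (a, f a) ∈ s := by
  choose f hf using hdom
  exact ⟨⟨⟨f, fun a b h => (hs.eq_iff _ (hf a) _ (hf b)).2 h⟩, fun g => isEmptyElim g,
    fun {k} R x => (hs.rel_iff k R (fun i => (x i, f (x i))) fun i => hf (x i)).symm⟩, hf⟩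

theorem IsPartialIso.exists_equiv [L.IsRelational] {s : Set (M × N)} (hs : IsPartialIso L s)
    (hdom : ∀ a, ∃ b, (a, b) ∈ s) (hcod : ∀ b, ∃ a, (a, b) ∈ s) :
    ∃ f : M ≃[L] N, ∀ p ∈ s, f p.1 = p.2 := by
  obtain ⟨f, hf⟩ := hs.exists_embedding hdom
  have hfs : ∀ p ∈ s, f p.1 = p.2 := fun p hp => (hs.eq_iff _ (hf p.1) _ hp).1 rfl
  have hbij : Function.Bijective f := ⟨f.injective, fun b => by
    obtain ⟨a, ha⟩ := hcod b
    exact ⟨a, hfs _ ha⟩⟩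
  exact ⟨⟨_root_.Equiv.ofBijective f hbij, fun g => isEmptyElim g, fun R x => f.map_rel R x⟩, hfs⟩

theorem IsGenericOver.exists_embedding [L.IsRelational] [Countable M] {S : Set T}
    (hS : IsCoreSet L S) {w' : N →[L] T} (hw' : IsGenericOver w' S) (w : M →[L] T)
    (w₀ : T →[L] M) : Nonempty (M ↪[L] N) := by
  have hempty : IsPartialLift w w' ∅ :=
    { eq_iff := fun p hp => hp.elim
      rel_iff := fun k R z hz => by
        cases k with
        | succ k => exact (hz 0).elim
        | zero =>
          refine ⟨fun h => hw'.nullary R _ ?_, fun h => ?_⟩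
          · convert w.map_rel R _ h
          · convert w₀.map_rel R _ (w'.map_rel R _ h)
      exists_hom := ⟨Hom.id L T, fun p hp => hp.elim⟩ }
  obtain ⟨s, hmono, -, hs, hdom⟩ := exists_chain (IsPartialLift w w')
    (fun a s => ∃ b, (a, b) ∈ s) (fun a s hfin hs => by
      obtain ⟨b, hb⟩ := hs.exists_insert hS hw' hfin a
      exact ⟨_, Set.subset_insert _ _, hfin.insert _, hb, b, Set.mem_insert _ _⟩)
    ∅ Set.finite_empty hempty
  obtain ⟨f, -⟩ := (IsPartialIso.iUnion hmono fun n => (hs n).toIsPartialIso).exists_embedding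
    fun a => by
      obtain ⟨n, b, hb⟩ := hdom a
      exact ⟨b, Set.mem_iUnion.2 ⟨n, hb⟩⟩
  exact ⟨f⟩

theorem IsGenericOver.exists_equiv [L.IsRelational] [Countable M] [Countable N] {S : Set T}
    (hS : IsCoreSet L S) {w : M →[L] T} (hw : IsGenericOver w S) {w' : N →[L] T}
    (hw' : IsGenericOver w' S) {s₀ : Set (M × N)} (hfin : s₀.Finite)
    (h₀ : IsPartialLift w w' s₀) : ∃ f : M ≃[L] N, ∀ p ∈ s₀, f p.1 = p.2 := by
  obtain ⟨s, hmono, rfl, hs, hD⟩ := exists_chain (IsPartialLift w w')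
    (fun (c : M ⊕ N) s => c.elim (fun a => ∃ b, (a, b) ∈ s) (fun b => ∃ a, (a, b) ∈ s))
    (fun c s hfin hs => by
      rcases c with a | b
      · obtain ⟨b, hb⟩ := hs.exists_insert hS hw' hfin a
        exact ⟨_, Set.subset_insert _ _, hfin.insert _, hb, b, Set.mem_insert _ _⟩
      · have hfin' : (Prod.swap ⁻¹' s : Set (N × M)).Finite :=
          hfin.preimage Prod.swap_injective.injOn
        obtain ⟨a, ha⟩ := (hs.swap hS hw.mem hfin).exists_insert hS hw hfin' b
        refine ⟨Prod.swap ⁻¹' insert (b, a) (Prod.swap ⁻¹' s),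
          fun p hp => Set.mem_insert_of_mem _ hp,
          (hfin'.insert _).preimage Prod.swap_injective.injOn,
          ha.swap hS hw'.mem (hfin'.insert _), a, Set.mem_insert _ _⟩)
    s₀ hfin h₀
  obtain ⟨f, hf⟩ := (IsPartialIso.iUnion hmono fun n => (hs n).toIsPartialIso).exists_equiv
    (fun a => by
      obtain ⟨n, b, hb⟩ := hD (Sum.inl a)
      exact ⟨b, Set.mem_iUnion.2 ⟨n, hb⟩⟩)
    (fun b => by
      obtain ⟨n, a, ha⟩ := hD (Sum.inr b)
      exact ⟨a, Set.mem_iUnion.2 ⟨n, ha⟩⟩)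
  exact ⟨f, fun p hp => hf p (Set.mem_iUnion.2 ⟨0, hp⟩)⟩

theorem IsGenericOver.autOligomorphic [L.IsRelational] [Finite (Σ n, L.Relations n)]
    [Countable M] (hT : WeaklyOligomorphic L T) {S : Set T} (hS : IsCoreSet L S)
    {w : M →[L] T} (hw : IsGenericOver w S) : AutOligomorphic L M := by
  intro n
  let up (x : Fin n → M) : {ρ : Set (Fin n → T) | EndInvariant L T ρ} :=
    ⟨{y | ∃ g : T →[L] T, ∀ i, g (w (x i)) = y i}, by
      rintro f y ⟨g, hg⟩
      exact ⟨f.comp g, fun i => congrArg f (hg i)⟩⟩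
  let ker (x : Fin n → M) : Set (Fin n × Fin n) := {q | x q.1 = x q.2}
  let diag (x : Fin n → M) : Set (Σ r : (Σ k, L.Relations k), (Fin r.1 → Fin n)) :=
    {q | RelMap q.1.2 (x ∘ q.2)}
  let φ (x : Fin n → M) := (up x, ker x, diag x)
  have := (hT n).to_subtype
  obtain ⟨σ, hσ⟩ : ∃ σ : Set.range φ → (Fin n → M), ∀ c, φ (σ c) = c :=
    ⟨fun c => c.2.choose, fun c => c.2.choose_spec⟩
  refine ⟨Set.range σ, Set.finite_range σ, fun x => ⟨_, ⟨⟨φ x, x, rfl⟩, rfl⟩, ?_⟩⟩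
  have hφ := hσ ⟨φ x, x, rfl⟩
  generalize σ ⟨φ x, x, rfl⟩ = y at hφ
  have hup : up y = up x := congrArg (·.1) hφ
  have hker : ker y = ker x := congrArg (·.2.1) hφ
  have hdiag : diag y = diag x := congrArg (·.2.2) hφ
  have hlift : IsPartialLift w w (Set.range fun i => (y i, x i)) :=
    { eq_iff := by
        rintro _ ⟨i, rfl⟩ _ ⟨j, rfl⟩
        exact Set.ext_iff.1 hker (i, j)
      rel_iff := fun k R z hz => by
        choose τ hτ using hz
        obtain rfl : (fun i => (y (τ i), x (τ i))) = z := funext hτ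
        exact Set.ext_iff.1 hdiag ⟨⟨k, R⟩, τ⟩
      exists_hom := by
        have hx : (fun i => w (x i)) ∈ (up y).1 := hup ▸ ⟨Hom.id L T, fun _ => rfl⟩
        obtain ⟨g, hg⟩ := hx
        refine ⟨g, ?_⟩
        rintro _ ⟨i, rfl⟩
        exact hg i }
  obtain ⟨f, hf⟩ := hw.exists_equiv hS hw (Set.finite_range _) hlift
  exact ⟨f, funext fun i => hf _ ⟨i, rfl⟩⟩

end BackAndForth

/-- For a countable weakly oligomorphic structure `T` over a finite
relational signature, the hom-equivalence class of `T` contains a greatest element whose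
automorphism group is oligomorphic. -/
theorem homEquivClass_has_oligomorphic_greatest (L : FirstOrder.Language.{u, v})
    [L.IsRelational] (hLf : Finite (Σ n, L.Relations n))
    (T : Type) [L.Structure T] [Countable T] (hT : WeaklyOligomorphic L T) :
    ∃ Ub : Bundled.{0} L.Structure, Countable Ub ∧
      Nonempty (Ub →[L] T) ∧ Nonempty (T →[L] Ub) ∧
      AutOligomorphic L Ub ∧
      ∀ A : Bundled.{0} L.Structure, Countable A →
        Nonempty (A →[L] T) → Nonempty (T →[L] A) → Nonempty (A ↪[L] Ub) := by
  obtain ⟨S, hS⟩ := hT.exists_isCoreSet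
  obtain ⟨U, _, hU, w, hw⟩ := exists_isGenericOver (L := L) S
  obtain ⟨f⟩ := hw.exists_embedding hS (Hom.id L T) (Hom.id L T)
  exact ⟨⟨U, inferInstance⟩, hU, ⟨w⟩, ⟨f.toHom⟩, hw.autOligomorphic hT hS,
    fun A _ ⟨h⟩ ⟨h₀⟩ => hw.exists_embedding hS h h₀⟩

end Stmt6
end

section
/- There exists a countable T-colored structure (U,u) in 𝒞̄ that is universal and homogeneous: (1) every countable T-colored structure (A,a) in 𝒞̄ admits an embedding ι : (A,a) ↪ (U,u); (2) for every finite T-colored structure (A,a) in 𝒞̄ and all embeddings ι₁, ι₂ : (A,a) ↪ (U,u) there exists an automorphism f of (U,u) with f ∘ ι₁ = ι₂. Moreover, any two countable universal homogeneous T-colored structures in 𝒞̄ are isomorphic as T-colored structures. -/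
open FirstOrder Language CategoryTheory

universe u v

namespace Stmt7

variable {L : FirstOrder.Language.{u, v}}

/-- The age of `M` is contained in the class `C` of finite structures. -/
def AgeIn (C : Set (Bundled.{0} L.Structure)) (M : Type*) [L.Structure M] : Prop :=
  ∀ A : Bundled.{0} L.Structure, Finite A → Nonempty (A ↪[L] M) → A ∈ C

/-- `A` is a countable structure whose age is contained in `C`, i.e. `A ∈ C̄`. -/
def InBar (C : Set (Bundled.{0} L.Structure)) (A : Bundled.{0} L.Structure) : Prop :=
  Countable A ∧ AgeIn C A

/-- A Fraïssé class of finite structures: nonempty, isomorphism-closed, countably many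
isomorphism types, hereditary, with the joint embedding and amalgamation properties. -/
structure IsFraisseClass (C : Set (Bundled.{0} L.Structure)) : Prop where
  nonempty : C.Nonempty
  finite : ∀ A ∈ C, Finite A
  isoInvariant : ∀ A B : Bundled.{0} L.Structure, Nonempty (A ≃[L] B) → (A ∈ C ↔ B ∈ C)
  countableTypes : ∃ S : Set (Bundled.{0} L.Structure), S.Countable ∧
    ∀ A ∈ C, ∃ B ∈ S, Nonempty (A ≃[L] B)
  hereditary : ∀ A ∈ C, ∀ B : Bundled.{0} L.Structure, Finite B → Nonempty (B ↪[L] A) → B ∈ C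
  jep : ∀ A ∈ C, ∀ B ∈ C, ∃ D ∈ C, Nonempty (A ↪[L] D) ∧ Nonempty (B ↪[L] D)
  amalgamation : ∀ A B₁ B₂ : Bundled.{0} L.Structure, A ∈ C → B₁ ∈ C → B₂ ∈ C →
    ∀ (f₁ : A ↪[L] B₁) (f₂ : A ↪[L] B₂),
      ∃ (D : Bundled.{0} L.Structure) (_ : D ∈ C) (g₁ : B₁ ↪[L] D) (g₂ : B₂ ↪[L] D),
        ∀ x, g₁ (f₁ x) = g₂ (f₂ x)

/-- `(P, g₁, g₂)` is a pushout of the pair of embeddings `(f₁, f₂)` in the category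
`(K̄, →)` of countable structures with age contained in `K`, with homomorphisms. -/
def IsPushoutIn (K : Set (Bundled.{0} L.Structure)) {A B₁ B₂ : Bundled.{0} L.Structure}
    (f₁ : A ↪[L] B₁) (f₂ : A ↪[L] B₂) (P : Bundled.{0} L.Structure)
    (g₁ : B₁ →[L] P) (g₂ : B₂ →[L] P) : Prop :=
  InBar K P ∧ (∀ x, g₁ (f₁ x) = g₂ (f₂ x)) ∧
  ∀ D : Bundled.{0} L.Structure, InBar K D →
    ∀ (h₁ : B₁ →[L] D) (h₂ : B₂ →[L] D), (∀ x, h₁ (f₁ x) = h₂ (f₂ x)) →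
      ∃! h : P →[L] D, h.comp g₁ = h₁ ∧ h.comp g₂ = h₂

/-- `(P, g₁, g₂)` is a coproduct of `B₁, B₂` in the category `(K̄, →)`. -/
def IsCoproductIn (K : Set (Bundled.{0} L.Structure)) (B₁ B₂ P : Bundled.{0} L.Structure)
    (g₁ : B₁ →[L] P) (g₂ : B₂ →[L] P) : Prop :=
  InBar K P ∧
  ∀ D : Bundled.{0} L.Structure, InBar K D → ∀ (h₁ : B₁ →[L] D) (h₂ : B₂ →[L] D),
    ∃! h : P →[L] D, h.comp g₁ = h₁ ∧ h.comp g₂ = h₂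

/-- A strict Fraïssé class: a Fraïssé class in which every pair of embeddings with common
domain has a pushout in `(K̄,→)`, and every pair of members has a coproduct in `(K̄,→)`. -/
def IsStrictFraisse (K : Set (Bundled.{0} L.Structure)) : Prop :=
  IsFraisseClass K ∧
  (∀ A B₁ B₂ : Bundled.{0} L.Structure, A ∈ K → B₁ ∈ K → B₂ ∈ K →
    ∀ (f₁ : A ↪[L] B₁) (f₂ : A ↪[L] B₂),
      ∃ (P : Bundled.{0} L.Structure) (g₁ : B₁ →[L] P) (g₂ : B₂ →[L] P),
        IsPushoutIn K f₁ f₂ P g₁ g₂) ∧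
  (∀ B₁ B₂ : Bundled.{0} L.Structure, B₁ ∈ K → B₂ ∈ K →
    ∃ (P : Bundled.{0} L.Structure) (g₁ : B₁ →[L] P) (g₂ : B₂ →[L] P),
      IsCoproductIn K B₁ B₂ P g₁ g₂)

/-- `C` is free in the strict Fraïssé class `K`: `C ⊆ K` and `C` is closed under the
canonical (pushout) amalgams and under finite coproducts taken in `(K̄,→)`. -/
def IsFreeIn (C K : Set (Bundled.{0} L.Structure)) : Prop :=
  C ⊆ K ∧
  (∀ A B₁ B₂ : Bundled.{0} L.Structure, A ∈ C → B₁ ∈ C → B₂ ∈ C →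
    ∀ (f₁ : A ↪[L] B₁) (f₂ : A ↪[L] B₂) (P : Bundled.{0} L.Structure)
      (g₁ : B₁ →[L] P) (g₂ : B₂ →[L] P), IsPushoutIn K f₁ f₂ P g₁ g₂ → P ∈ C) ∧
  (∀ B₁ B₂ : Bundled.{0} L.Structure, B₁ ∈ C → B₂ ∈ C →
    ∀ (P : Bundled.{0} L.Structure) (g₁ : B₁ →[L] P) (g₂ : B₂ →[L] P),
      IsCoproductIn K B₁ B₂ P g₁ g₂ → P ∈ C)

/-- `(U,u)` is a universal `T`-colored structure in `C̄`: every countable `T`-colored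
structure `(A,a)` in `C̄` admits an embedding `ι : A ↪ U` with `u ∘ ι = a`. -/
def ColUniversal (C : Set (Bundled.{0} L.Structure)) {T : Type*} [L.Structure T]
    (Ub : Bundled.{0} L.Structure) (u : Ub →[L] T) : Prop :=
  ∀ (A : Bundled.{0} L.Structure) (a : A →[L] T), InBar C A →
    ∃ ι : A ↪[L] Ub, ∀ x, u (ι x) = a x

/-- `(U,u)` is a homogeneous `T`-colored structure in `C̄`: any two embeddings of a finite
`T`-colored structure `(A,a)` of `C̄` into `(U,u)` differ by an automorphism of `(U,u)`. -/
def ColHomogeneous (C : Set (Bundled.{0} L.Structure)) {T : Type*} [L.Structure T]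
    (Ub : Bundled.{0} L.Structure) (u : Ub →[L] T) : Prop :=
  ∀ (A : Bundled.{0} L.Structure) (a : A →[L] T), InBar C A → Finite A →
    ∀ ι₁ ι₂ : A ↪[L] Ub, (∀ x, u (ι₁ x) = a x) → (∀ x, u (ι₂ x) = a x) →
      ∃ f : Ub ≃[L] Ub, (∀ y, u (f y) = u y) ∧ ∀ x, f (ι₁ x) = ι₂ x

section Generic

/-- `M` embeds every member of `K` and extends embeddings along embeddings between members
of `K`. -/
structure IsRich (K : Set (Bundled.{0} L.Structure)) (M : Type*) [L.Structure M] : Prop where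
  embeds : ∀ A ∈ K, Nonempty (A ↪[L] M)
  extends_along : ∀ A ∈ K, ∀ B ∈ K, ∀ (e : A ↪[L] B) (f : A ↪[L] M),
    ∃ g : B ↪[L] M, ∀ x, g (e x) = f x

/-- Every countable structure with age in `K` embeds into `M`. -/
def IsUniversal (K : Set (Bundled.{0} L.Structure)) (M : Type*) [L.Structure M] : Prop :=
  ∀ A : Bundled.{0} L.Structure, InBar K A → Nonempty (A ↪[L] M)

/-- Any two embeddings of a member of `K` into `M` differ by an automorphism of `M`. -/
def IsHomogeneous (K : Set (Bundled.{0} L.Structure)) (M : Type*) [L.Structure M] : Prop :=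
  ∀ A ∈ K, ∀ f₁ f₂ : A ↪[L] M, ∃ g : M ≃[L] M, ∀ x, g (f₁ x) = f₂ x

variable {K : Set (Bundled.{0} L.Structure)}

theorem IsFraisseClass.inBar (hK : IsFraisseClass K) {A : Bundled.{0} L.Structure} (hA : A ∈ K) :
    InBar K A :=
  ⟨have := hK.finite A hA; Finite.to_countable, fun B hB hBA => hK.hereditary A hA B hB hBA⟩

/-- Finitely many extension problems over a member of `K` can be solved simultaneously. -/
theorem IsFraisseClass.exists_solution (hK : IsFraisseClass K) {M : Bundled.{0} L.Structure}
    (hM : M ∈ K) {ι : Type*} (A B : ι → Bundled.{0} L.Structure) (hA : ∀ i, A i ∈ K)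
    (hB : ∀ i, B i ∈ K) (e : ∀ i, A i ↪[L] B i) (f : ∀ i, A i ↪[L] M) (l : List ι) :
    ∃ N ∈ K, ∃ g : M ↪[L] N, ∀ i ∈ l, ∃ k : B i ↪[L] N, ∀ x, k (e i x) = g (f i x) := by
  induction l with
  | nil => exact ⟨M, hM, Embedding.refl L M, by simp⟩
  | cons i l ih =>
    obtain ⟨N, hN, g, hg⟩ := ih
    obtain ⟨D, hD, g₁, g₂, h⟩ := hK.amalgamation (A i) N (B i) (hA i) hN (hB i) (g.comp (f i)) (e i)
    refine ⟨D, hD, g₁.comp g, fun j hj => ?_⟩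
    rcases List.mem_cons.1 hj with rfl | hj
    · exact ⟨g₂, fun x => (h x).symm⟩
    · obtain ⟨k, hk⟩ := hg j hj
      exact ⟨g₁.comp k, fun x => congrArg g₁ (hk x)⟩

theorem finite_embedding (A B : Type*) [L.Structure A] [L.Structure B] [Finite A] [Finite B] :
    Finite (A ↪[L] B) :=
  Finite.of_injective (fun f => (f : A → B)) DFunLike.coe_injective

theorem IsFraisseClass.isRich_of_universal_of_homogeneous (hK : IsFraisseClass K)
    {M : Type*} [L.Structure M] (hu : IsUniversal K M) (hh : IsHomogeneous K M) : IsRich K M where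
  embeds A hA := hu A (hK.inBar hA)
  extends_along A hA B hB e f := by
    obtain ⟨k⟩ := hu B (hK.inBar hB)
    obtain ⟨g, hg⟩ := hh A hA (k.comp e) f
    exact ⟨g.toEmbedding.comp k, hg⟩

theorem IsFraisseClass.exists_step (hK : IsFraisseClass K) (X Y : ℕ → Bundled.{0} L.Structure)
    (hX : ∀ n, X n ∈ K) (hY : ∀ n, Y n ∈ K) (e : ∀ n, X n ↪[L] Y n) (n : ℕ)
    {M : Bundled.{0} L.Structure} (hM : M ∈ K) :
    ∃ N ∈ K, Nonempty (X n ↪[L] N) ∧ ∃ g : M ↪[L] N,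
      ∀ j ≤ n, ∀ f : X j ↪[L] M, ∃ k : Y j ↪[L] N, ∀ x, k (e j x) = g (f x) := by
  have := hK.finite M hM
  have (j : ℕ) := hK.finite _ (hX j)
  have (j : ℕ) : Finite (X j ↪[L] M) := finite_embedding _ _
  have := Fintype.ofFinite (Σ j : Fin (n + 1), (X j ↪[L] M))
  obtain ⟨N, hN, g, hg⟩ := hK.exists_solution hM
    (ι := Σ j : Fin (n + 1), (X j ↪[L] M)) (fun i => X i.1) (fun i => Y i.1) (fun i => hX i.1)
    (fun i => hY i.1) (fun i => e i.1) (fun i => i.2) Finset.univ.toList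
  obtain ⟨D, hD, ⟨g₁⟩, ⟨g₂⟩⟩ := hK.jep N hN (X n) (hX n)
  refine ⟨D, hD, ⟨g₂⟩, g₁.comp g, fun j hj f => ?_⟩
  obtain ⟨k, hk⟩ := hg ⟨⟨j, Nat.lt_succ_of_le hj⟩, f⟩ (by simp)
  exact ⟨g₁.comp k, fun x => congrArg g₁ (hk x)⟩

/-- Up to isomorphism there are countably many embeddings between members of `K`. -/
theorem IsFraisseClass.exists_sequence (hK : IsFraisseClass K) :
    ∃ (X Y : ℕ → Bundled.{0} L.Structure) (e : ∀ n, X n ↪[L] Y n),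
      (∀ n, X n ∈ K) ∧ (∀ n, Y n ∈ K) ∧
      ∀ A ∈ K, ∀ B ∈ K, ∀ f : A ↪[L] B, ∃ (n : ℕ) (a : A ≃[L] X n) (b : B ≃[L] Y n),
        ∀ x, e n (a x) = b (f x) := by
  obtain ⟨S, hS, hrep⟩ := hK.countableTypes
  let S' : Set (Bundled.{0} L.Structure) := S ∩ K
  have : Countable S' := (hS.mono Set.inter_subset_left).to_subtype
  have hrep' : ∀ A ∈ K, ∃ B : S', Nonempty (A ≃[L] B.1) := fun A hA =>
    let ⟨B, hB, h⟩ := hrep A hA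
    ⟨⟨B, hB, (hK.isoInvariant A B h).1 hA⟩, h⟩
  have (p : S') := hK.finite p.1 p.2.2
  have (p : S' × S') : Finite (p.1.1 ↪[L] p.2.1) := finite_embedding _ _
  obtain ⟨A₀, hA₀⟩ := hK.nonempty
  obtain ⟨B₀, -⟩ := hrep' A₀ hA₀
  have : Nonempty (Σ p : S' × S', (p.1.1 ↪[L] p.2.1)) := ⟨⟨(B₀, B₀), Embedding.refl L _⟩⟩
  obtain ⟨F, hF⟩ := exists_surjective_nat (Σ p : S' × S', (p.1.1 ↪[L] p.2.1))
  refine ⟨fun n => (F n).1.1.1, fun n => (F n).1.2.1, fun n => (F n).2,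
    fun n => (F n).1.1.2.2, fun n => (F n).1.2.2.2, fun A hA B hB f => ?_⟩
  obtain ⟨A', ⟨a⟩⟩ := hrep' A hA
  obtain ⟨B', ⟨b⟩⟩ := hrep' B hB
  obtain ⟨n, hn⟩ := hF ⟨(A', B'), b.toEmbedding.comp (f.comp a.symm.toEmbedding)⟩
  refine ⟨n, ?_⟩
  beta_reduce
  rw [hn]
  exact ⟨a, b, fun x => by simp⟩

variable [L.IsRelational]

/-- An embedding whose values all lie in the range of an embedding `g` factors through `g`. -/
theorem exists_factor {A M N : Type*} [L.Structure A] [L.Structure M] [L.Structure N]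
    (g : N ↪[L] M) (e : A ↪[L] M) (h : ∀ x, ∃ y, g y = e x) :
    ∃ e' : A ↪[L] N, ∀ x, g (e' x) = e x := by
  choose k hk using h
  refine ⟨⟨⟨k, fun x y hxy => e.injective ?_⟩, fun f => isEmptyElim f, fun r x => ?_⟩, hk⟩
  · rw [← hk, ← hk, hxy]
  · rw [← g.map_rel, ← e.map_rel]
    exact iff_of_eq (congrArg _ (funext fun i => hk (x i)))

theorem AgeIn.mk_mem {M : Bundled.{0} L.Structure} (hM : AgeIn K M) {S : L.Substructure M}
    (hS : S.FG) : (⟨S, inferInstance⟩ : Bundled.{0} L.Structure) ∈ K :=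
  hM _ hS.finite ⟨S.subtype⟩

theorem IsRich.isExtensionPair {M : Bundled.{0} L.Structure} {N : Type*} [L.Structure N]
    (hM : AgeIn K M) (hN : IsRich K N) : L.IsExtensionPair M N := by
  rw [isExtensionPair_iff_exists_embedding_closure_singleton_sup]
  intro S hS f m
  obtain ⟨g, hg⟩ := hN.extends_along _ (hM.mk_mem hS) _
    (hM.mk_mem ((Substructure.fg_closure_singleton m).sup hS))
    (Substructure.inclusion le_sup_right) f
  exact ⟨g, Embedding.ext fun x => (hg x).symm⟩

theorem IsRich.exists_fgEquiv {M : Bundled.{0} L.Structure} {N : Type*} [L.Structure N]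
    (hM : AgeIn K M) (hN : IsRich K N) : Nonempty (L.FGEquiv M N) := by
  have hbot : (⊥ : L.Substructure M).FG := Substructure.fg_bot
  obtain ⟨f⟩ := hN.embeds _ (hM.mk_mem hbot)
  exact ⟨⟨⟨⊥, f.toHom.range, f.equivRange⟩, hbot⟩⟩

theorem IsRich.isUniversal {N : Type*} [L.Structure N] (hN : IsRich K N) : IsUniversal K N := by
  rintro M ⟨_, hM⟩
  obtain ⟨g⟩ := hN.exists_fgEquiv hM
  exact ⟨(embedding_from_cg Structure.cg_of_countable g (hN.isExtensionPair hM)).choose⟩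

theorem IsRich.nonempty_equiv {M N : Bundled.{0} L.Structure} (hM : InBar K M) (hN : InBar K N)
    (rM : IsRich K M) (rN : IsRich K N) : Nonempty (M ≃[L] N) := by
  obtain ⟨_, hM⟩ := hM
  obtain ⟨_, hN⟩ := hN
  obtain ⟨g⟩ := rN.exists_fgEquiv hM
  exact ⟨(equiv_between_cg Structure.cg_of_countable Structure.cg_of_countable g
    (rN.isExtensionPair hM) (rM.isExtensionPair hN)).choose⟩

theorem IsRich.isHomogeneous (hK : IsFraisseClass K) {M : Bundled.{0} L.Structure}
    (hM : InBar K M) (rM : IsRich K M) : IsHomogeneous K M := by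
  obtain ⟨_, hM⟩ := hM
  intro A hA f₁ f₂
  have := hK.finite A hA
  have hfg : f₁.toHom.range.FG := Structure.FG.range Structure.FG.of_finite _
  obtain ⟨g, hle, hg⟩ := equiv_between_cg Structure.cg_of_countable Structure.cg_of_countable
    ⟨⟨f₁.toHom.range, f₂.toHom.range, f₂.equivRange.comp f₁.equivRange.symm⟩, hfg⟩
    (rM.isExtensionPair hM) (rM.isExtensionPair hM)
  refine ⟨g, fun x => ?_⟩
  have h := DFunLike.congr_fun hg (f₁.equivRange x)
  have h' : g (f₁ x) = f₂.equivRange (f₁.equivRange.symm (f₁.equivRange x)) := h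
  have hx : f₁.equivRange.symm (f₁.equivRange x) = x := f₁.equivRange.symm_apply_apply x
  exact h'.trans (congrArg (fun y => (f₂.equivRange y : M)) hx)

theorem IsFraisseClass.exists_isRich (hK : IsFraisseClass K) :
    ∃ M : Bundled.{0} L.Structure, InBar K M ∧ IsRich K M := by
  obtain ⟨X, Y, e, hX, hY, hXY⟩ := hK.exists_sequence
  choose N hN hXN s hs using fun (n : ℕ) (M : K) => hK.exists_step X Y hX hY e n M.2
  let G : ℕ → K := fun n =>
    Nat.rec (motive := fun _ => K) ⟨X 0, hX 0⟩ (fun n M => ⟨N n M, hN n M⟩) n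
  let G' : ℕ → Bundled.{0} L.Structure := fun n => (G n).1
  let t : ∀ n, G' n ↪[L] G' (n + 1) := fun n => s n (G n)
  let f : ∀ i j, i ≤ j → G' i ↪[L] G' j := DirectedSystem.natLERec t
  let M := Language.DirectLimit (fun n => G' n) f
  have hfin (n : ℕ) : Finite (G' n) := hK.finite _ (G n).2
  have hcg : Structure.CG L M :=
    Language.DirectLimit.cg _ fun n => Structure.cg_of_countable
  have hcount : Countable M := Structure.cg_iff_countable.1 hcg
  have factor {A : Type} [L.Structure A] [Finite A] (g : A ↪[L] M) :
      ∃ i, ∃ h : A ↪[L] G' i, ∀ x, Language.DirectLimit.of L ℕ (fun n => G' n) f i (h x) = g x := by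
    obtain ⟨i, T, hT⟩ := Language.DirectLimit.exists_fg_substructure_in_Sigma g.toHom.range
      (Structure.FG.range Structure.FG.of_finite _)
    refine ⟨i, exists_factor _ _ fun x => ?_⟩
    have hx : g x ∈ T.map (Language.DirectLimit.of L ℕ (fun n => G' n) f i).toHom := by
      rw [hT]
      exact ⟨x, rfl⟩
    obtain ⟨y, -, hy⟩ := hx
    exact ⟨y, hy⟩
  refine ⟨⟨M, inferInstance⟩, ⟨hcount, fun A hA ⟨g⟩ => ?_⟩, fun A hA => ?_, fun A hA B hB h g => ?_⟩
  · obtain ⟨i, h, -⟩ := factor g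
    exact hK.hereditary _ (G i).2 A hA ⟨h⟩
  · obtain ⟨n, a, -⟩ := hXY A hA A hA (Embedding.refl L A)
    obtain ⟨k⟩ := hXN n (G n)
    exact ⟨(Language.DirectLimit.of L ℕ (fun n => G' n) f (n + 1)).comp
      (Embedding.comp (N := X n) k a.toEmbedding)⟩
  · obtain ⟨n, a, b, hab⟩ := hXY A hA B hB h
    have := hK.finite A hA
    obtain ⟨i, g', hg'⟩ := factor g
    let m := max i n
    obtain ⟨k, hk⟩ := hs m (G m) n (le_max_right _ _)
      ((f i m (le_max_left _ _)).comp (g'.comp a.symm.toEmbedding))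
    let k' : Y n ↪[L] G' (m + 1) := k
    refine ⟨(Language.DirectLimit.of L ℕ (fun n => G' n) f (m + 1)).comp (k'.comp b.toEmbedding),
      fun x => ?_⟩
    have h1 : k' (b (h x)) = t m (f i m (le_max_left _ _) (g' x)) := by
      rw [← hab]
      refine (hk (a x)).trans ?_
      simp [t]
    have h2 : t m (f i m (le_max_left _ _) (g' x)) =
        f i (m + 1) ((le_max_left _ _).trans (Nat.le_succ m)) (g' x) := by
      simp only [f, DirectedSystem.coe_natLERec]
      rw [Nat.leRecOn_succ]
    change Language.DirectLimit.of L ℕ (fun n => G' n) f (m + 1) (k' (b (h x))) = g x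
    rw [h1, h2, Language.DirectLimit.of_f, hg']

end Generic

section Colored

variable (L) in
/-- The language `L` with, in each arity, a new relation symbol for each color in `T`. -/
def colorLang (T : Type) : FirstOrder.Language.{u, v} :=
  ⟨L.Functions, fun n => L.Relations n ⊕ T⟩

instance [h : L.IsRelational] (T : Type) : (colorLang L T).IsRelational := h

variable {T : Type}

/-- The color symbol `t` in arity `n`. -/
def colorSymbol (n : ℕ) (t : T) : (colorLang L T).Relations n := Sum.inr t

/-- The relation symbol of the colored language given by a relation symbol of `L`. -/
def baseSymbol {n : ℕ} (r : L.Relations n) : (colorLang L T).Relations n := Sum.inl r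

/-- The `L`-reduct of a structure in the colored language. -/
def reduct (M : Bundled.{0} (colorLang L T).Structure) : Bundled.{0} L.Structure :=
  ⟨M, { funMap := fun {_} f x => M.str.funMap f x
        RelMap := fun {_} r x => M.str.RelMap (Sum.inl r) x }⟩

/-- The structure in the colored language given by an `L`-structure and a coloring; the symbol
for the color `t` holds of the tuples all of whose entries have color `t`. -/
def colored (A : Bundled.{0} L.Structure) (a : A → T) : Bundled.{0} (colorLang L T).Structure :=
  ⟨A, { funMap := fun {_} f x => A.str.funMap f x
        RelMap := fun {_} r x =>
          Sum.elim (fun r => A.str.RelMap r x) (fun t => ∀ i, a (x i) = t) r }⟩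

section Maps

variable {A B : Bundled.{0} L.Structure} {a : A → T} {b : B → T}

/-- A color-preserving embedding of `L`-structures, as an embedding in the colored language. -/
def coloredEmbedding (f : A ↪[L] B) (h : ∀ x, b (f x) = a x) :
    colored A a ↪[colorLang L T] colored B b where
  toFun := f
  inj' := f.injective
  map_fun' g x := f.map_fun' g x
  map_rel' {n} r x := by
    rcases r with r | t
    · exact f.map_rel r x
    · exact forall_congr' fun i => iff_of_eq (congrArg (· = t) (h (x i)))

theorem color_eq_of_embedding (g : colored A a ↪[colorLang L T] colored B b) (x : colored A a) :
    b (g x) = a x :=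
  (g.map_rel (colorSymbol (L := L) 1 (a x)) fun _ => x).2 (fun _ => rfl) 0

/-- The `L`-embedding underlying an embedding in the colored language. -/
def embeddingOfColored (g : colored A a ↪[colorLang L T] colored B b) : A ↪[L] B where
  toFun := g
  inj' := g.injective
  map_fun' f x := g.map_fun' f x
  map_rel' r x := g.map_rel (baseSymbol (T := T) r) x

/-- A color-preserving isomorphism of `L`-structures, as an isomorphism in the colored language. -/
def coloredEquiv (f : A ≃[L] B) (h : ∀ x, b (f x) = a x) :
    colored A a ≃[colorLang L T] colored B b where
  toEquiv := f.toEquiv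
  map_fun' := (coloredEmbedding f.toEmbedding h).map_fun'
  map_rel' r x := (coloredEmbedding f.toEmbedding h).map_rel' r x

/-- The `L`-isomorphism underlying an isomorphism in the colored language. -/
def equivOfColored (g : colored A a ≃[colorLang L T] colored B b) : A ≃[L] B where
  toEquiv := g.toEquiv
  map_fun' := (embeddingOfColored g.toEmbedding).map_fun'
  map_rel' r x := (embeddingOfColored g.toEmbedding).map_rel' r x

/-- A structure in the colored language whose color symbols are interpreted according to a
coloring is the colored structure on its reduct. -/
def equivColoredReduct {M : Bundled.{0} (colorLang L T).Structure} (a : M → T)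
    (h : ∀ (n : ℕ) (t : T) (x : Fin n → M),
      Structure.RelMap (colorSymbol (L := L) n t) x ↔ ∀ i, a (x i) = t) :
    M ≃[colorLang L T] colored (reduct M) a where
  toEquiv := _root_.Equiv.refl M
  map_fun' _ _ := rfl
  map_rel' {n} r x := by
    rcases r with r | t
    · exact Iff.rfl
    · exact (h n t x).symm

theorem exists_equiv_colored_of_embedding [L.Structure T]
    {M : Bundled.{0} (colorLang L T).Structure} (a : A →[L] T)
    (g : M ↪[colorLang L T] colored A a) :
    ∃ b : reduct M →[L] T, Nonempty (M ≃[colorLang L T] colored (reduct M) b) ∧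
      Nonempty (reduct M ↪[L] A) := by
  let f : reduct M ↪[L] A :=
    { toFun := g
      inj' := g.injective
      map_fun' := fun f x => g.map_fun' f x
      map_rel' := fun r x => g.map_rel (baseSymbol (T := T) r) x }
  exact ⟨a.comp f.toHom, ⟨equivColoredReduct _ fun n t x =>
    (g.map_rel (colorSymbol (L := L) n t) x).symm⟩, ⟨f⟩⟩

end Maps

theorem exists_embedding_of_comp_eq {B P D : Type*} [L.Structure B] [L.Structure P]
    [L.Structure D] (g : B →[L] P) (h : P →[L] D) (k : B ↪[L] D) (hk : h.comp g = k.toHom) :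
    ∃ g' : B ↪[L] P, ∀ x, g' x = g x := by
  have hk' : ∀ x, h (g x) = k x := DFunLike.congr_fun hk
  refine ⟨⟨⟨g, fun x y hxy => k.injective ?_⟩, fun f x => g.map_fun f x, fun r x =>
    ⟨fun hr => ?_, fun hr => g.map_rel r x hr⟩⟩, fun _ => rfl⟩
  · rw [← hk', ← hk']
    exact congrArg h hxy
  · rw [← k.map_rel]
    have := h.map_rel r _ hr
    rwa [show h ∘ _ ∘ x = k ∘ x from funext fun i => hk' (x i)] at this

variable [L.Structure T]

variable (T) in
/-- The structures in the colored language that come from a member of `C` colored by a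
homomorphism to `T`. -/
def coloredClass (C : Set (Bundled.{0} L.Structure)) :
    Set (Bundled.{0} (colorLang L T).Structure) :=
  {M | ∃ A ∈ C, ∃ a : A →[L] T, Nonempty (M ≃[colorLang L T] colored A a)}

theorem InBar.of_equiv {K : Set (Bundled.{0} L.Structure)} {M N : Bundled.{0} L.Structure}
    (hM : InBar K M) (e : M ≃[L] N) : InBar K N :=
  ⟨have := hM.1; e.symm.injective.countable,
    fun A hA ⟨f⟩ => hM.2 A hA ⟨e.symm.toEmbedding.comp f⟩⟩

theorem IsRich.of_equiv {K : Set (Bundled.{0} L.Structure)} {M N : Type*} [L.Structure M]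
    [L.Structure N] (hM : IsRich K M) (e : M ≃[L] N) : IsRich K N where
  embeds A hA := (hM.embeds A hA).map e.toEmbedding.comp
  extends_along A hA B hB f g := by
    obtain ⟨k, hk⟩ := hM.extends_along A hA B hB f (e.symm.toEmbedding.comp g)
    exact ⟨e.toEmbedding.comp k, fun x => by simp [hk]⟩

variable {U C : Set (Bundled.{0} L.Structure)}

theorem colored_mem {A : Bundled.{0} L.Structure} (hA : A ∈ C) (a : A →[L] T) :
    colored A a ∈ coloredClass T C :=
  ⟨A, hA, a, ⟨Language.Equiv.refl (colorLang L T) (colored A a)⟩⟩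

theorem IsFraisseClass.mem_of_colored_mem (hC : IsFraisseClass C) {A : Bundled.{0} L.Structure}
    {a : A → T} (h : colored A a ∈ coloredClass T C) : A ∈ C := by
  obtain ⟨B, hB, b, ⟨e⟩⟩ := h
  exact (hC.isoInvariant A B ⟨equivOfColored e⟩).2 hB

theorem IsFraisseClass.coloredClass_hereditary (hC : IsFraisseClass C)
    (M : Bundled.{0} (colorLang L T).Structure) (hM : M ∈ coloredClass T C)
    (N : Bundled.{0} (colorLang L T).Structure) (hN : Finite N)
    (h : Nonempty (N ↪[colorLang L T] M)) : N ∈ coloredClass T C := by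
  obtain ⟨A, hA, a, ⟨e⟩⟩ := hM
  obtain ⟨f⟩ := h
  obtain ⟨b, hb, hbA⟩ := exists_equiv_colored_of_embedding a (e.toEmbedding.comp f)
  exact ⟨reduct N, hC.hereditary A hA _ hN hbA, b, hb⟩

theorem InBar.colored {A : Bundled.{0} L.Structure} (hA : InBar C A) (a : A →[L] T) :
    InBar (coloredClass T C) (colored A a) := by
  refine ⟨hA.1, fun N hN ⟨f⟩ => ?_⟩
  obtain ⟨b, hb, hbA⟩ := exists_equiv_colored_of_embedding a f
  exact ⟨reduct N, hA.2 _ hN hbA, b, hb⟩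

theorem IsFraisseClass.inBar_of_inBar_colored (hC : IsFraisseClass C)
    {A : Bundled.{0} L.Structure} {a : A → T} (h : InBar (coloredClass T C) (colored A a)) :
    InBar C A :=
  ⟨h.1, fun _ hB ⟨f⟩ => hC.mem_of_colored_mem (a := a ∘ f)
    (h.2 _ hB ⟨coloredEmbedding f fun _ => rfl⟩)⟩

theorem exists_tuple_coloring [L.IsRelational] {M : Bundled.{0} (colorLang L T).Structure}
    (hM : AgeIn (coloredClass T C) M) {n : ℕ} (x : Fin n → M) :
    ∃ b : Fin n → T,
      (∀ (k : ℕ) (s : Fin k → Fin n) (t : T),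
        Structure.RelMap (colorSymbol (L := L) k t) (x ∘ s) ↔ ∀ i, b (s i) = t) ∧
      ∀ r : L.Relations n, Structure.RelMap (baseSymbol (T := T) r) x → Structure.RelMap r b := by
  let S := Substructure.closure (colorLang L T) (Set.range x)
  have hS : S.FG := Substructure.fg_closure (Set.finite_range x)
  obtain ⟨A, -, a, ⟨e⟩⟩ := hM.mk_mem hS
  let y : Fin n → S := fun i => ⟨x i, Substructure.subset_closure ⟨i, rfl⟩⟩
  refine ⟨fun i => a (e (y i)), fun k s t => ?_, fun r hr => ?_⟩
  · exact (e.map_rel (colorSymbol (L := L) k t) (y ∘ s)).symm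
  · exact a.map_rel r _ ((e.map_rel (baseSymbol (T := T) r) y).2 hr)

theorem exists_equiv_colored [L.IsRelational] {M : Bundled.{0} (colorLang L T).Structure}
    (hM : AgeIn (coloredClass T C) M) :
    ∃ (A : Bundled.{0} L.Structure) (a : A →[L] T),
      Nonempty (M ≃[colorLang L T] colored A a) := by
  have hpt : ∀ m : M, ∃ c : T, ∀ t,
      Structure.RelMap (colorSymbol (L := L) 1 t) (fun _ => m) ↔ c = t := fun m => by
    obtain ⟨b, hb, -⟩ := exists_tuple_coloring hM (fun _ : Fin 1 => m)
    exact ⟨b 0, fun t => (hb 1 id t).trans Fin.forall_fin_one⟩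
  choose c hc using hpt
  have htuple : ∀ (n : ℕ) (x : Fin n → M),
      (∀ t, Structure.RelMap (colorSymbol (L := L) n t) x ↔ ∀ i, c (x i) = t) ∧
      ∀ r : L.Relations n, Structure.RelMap (baseSymbol (T := T) r) x →
        Structure.RelMap r (c ∘ x) := by
    intro n x
    obtain ⟨b, hb, hr⟩ := exists_tuple_coloring hM x
    obtain rfl : b = c ∘ x := funext fun i =>
      (((hc (x i) (b i)).1 ((hb 1 (fun _ => i) (b i)).2 fun _ => rfl))).symm
    exact ⟨fun t => hb n id t, hr⟩
  exact ⟨reduct M, ⟨c, fun f => isEmptyElim f, fun {n} r x => (htuple n x).2 r⟩,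
    ⟨equivColoredReduct c fun n t x => (htuple n x).1 t⟩⟩

/-- A finite structure in a Fraïssé class without elements maps to every structure with age in
the class. -/
theorem IsFraisseClass.nonempty_hom_of_isEmpty [L.IsRelational] (hU : IsFraisseClass U)
    {E M : Bundled.{0} L.Structure} [IsEmpty E] (hE : E ∈ U) (hM : AgeIn U M) :
    Nonempty (E →[L] M) := by
  have hbot : (⊥ : L.Substructure M).FG := Substructure.fg_bot
  obtain ⟨D, -, ⟨f⟩, ⟨g⟩⟩ := hU.jep E hE _ (hM.mk_mem hbot)
  refine ⟨⟨isEmptyElim, fun f => isEmptyElim f, fun {n} r x hr => ?_⟩⟩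
  cases n with
  | succ n => exact isEmptyElim (x 0)
  | zero =>
    let y : Fin 0 → (⊥ : L.Substructure M) := Fin.elim0
    have hy : Structure.RelMap r y := by
      rw [← g.map_rel]
      rwa [← f.map_rel, Subsingleton.elim (f ∘ x) (g ∘ y)] at hr
    have := (Substructure.subtype (⊥ : L.Substructure M)).toHom.map_rel r y hy
    rwa [Subsingleton.elim (isEmptyElim ∘ x) ((Substructure.subtype _).toHom ∘ y)]

theorem IsFraisseClass.coloredClass_nonempty [L.IsRelational] (hU : IsFraisseClass U)
    (hC : IsFraisseClass C) (hCU : C ⊆ U) (hT : AgeIn U T) : (coloredClass T C).Nonempty := by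
  obtain ⟨A, hA⟩ := hC.nonempty
  have hE := (hC.inBar hA).2.mk_mem (S := (⊥ : L.Substructure A)) Substructure.fg_bot
  have hempty : IsEmpty (⊥ : L.Substructure A) := by
    refine ⟨fun ⟨x, hx⟩ => ?_⟩
    rwa [← Substructure.closure_empty, Substructure.mem_closure_iff_of_isRelational] at hx
  obtain ⟨a⟩ := hU.nonempty_hom_of_isEmpty (E := ⟨(⊥ : L.Substructure A), inferInstance⟩)
    (M := ⟨T, inferInstance⟩) (hCU hE) hT
  exact ⟨_, colored_mem hE a⟩

theorem IsFraisseClass.coloredClass_countableTypes [Countable T] (hC : IsFraisseClass C) :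
    ∃ S : Set (Bundled.{0} (colorLang L T).Structure), S.Countable ∧
      ∀ M ∈ coloredClass T C, ∃ N ∈ S, Nonempty (M ≃[colorLang L T] N) := by
  obtain ⟨S, hS, hrep⟩ := hC.countableTypes
  let S' : Set (Bundled.{0} L.Structure) := S ∩ C
  have : Countable S' := (hS.mono Set.inter_subset_left).to_subtype
  have (B : S') : Countable (B.1 →[L] T) :=
    have := hC.finite _ B.2.2
    DFunLike.coe_injective.countable (f := fun f : B.1 →[L] T => (f : B.1 → T))
  refine ⟨Set.range fun p : Σ B : S', (B.1 →[L] T) => colored p.1.1 p.2,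
    Set.countable_range _, ?_⟩
  rintro M ⟨A, hA, a, ⟨e⟩⟩
  obtain ⟨B, hB, ⟨f⟩⟩ := hrep A hA
  let b : B →[L] T := a.comp f.symm.toHom
  refine ⟨_, ⟨⟨⟨B, hB, (hC.isoInvariant A B ⟨f⟩).1 hA⟩, b⟩, rfl⟩, ⟨Equiv.comp ?_ e⟩⟩
  exact coloredEquiv f fun x => congrArg a (f.symm_apply_apply x)

theorem coloredClass_jep [Countable T] (hU : IsStrictFraisse U) (hC : IsFraisseClass C)
    (hfree : IsFreeIn C U) (hT : AgeIn U T) {B₁ B₂ : Bundled.{0} L.Structure} (h₁ : B₁ ∈ C)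
    (h₂ : B₂ ∈ C) (b₁ : B₁ →[L] T) (b₂ : B₂ →[L] T) :
    ∃ D ∈ coloredClass T C, Nonempty (colored B₁ b₁ ↪[colorLang L T] D) ∧
      Nonempty (colored B₂ b₂ ↪[colorLang L T] D) := by
  obtain ⟨P, g₁, g₂, hP⟩ := hU.2.2 B₁ B₂ (hfree.1 h₁) (hfree.1 h₂)
  obtain ⟨D, hD, ⟨k₁⟩, ⟨k₂⟩⟩ := hC.jep B₁ h₁ B₂ h₂
  obtain ⟨h, ⟨hh₁, hh₂⟩, -⟩ := hP.2 D (hU.1.inBar (hfree.1 hD)) k₁.toHom k₂.toHom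
  obtain ⟨p, ⟨hp₁, hp₂⟩, -⟩ := hP.2 ⟨T, inferInstance⟩ ⟨‹_›, hT⟩ b₁ b₂
  obtain ⟨e₁, he₁⟩ := exists_embedding_of_comp_eq g₁ h k₁ hh₁
  obtain ⟨e₂, he₂⟩ := exists_embedding_of_comp_eq g₂ h k₂ hh₂
  refine ⟨_, colored_mem (hfree.2.2 B₁ B₂ h₁ h₂ P g₁ g₂ hP) p,
    ⟨coloredEmbedding e₁ fun x => ?_⟩, ⟨coloredEmbedding e₂ fun x => ?_⟩⟩
  · rw [he₁]
    exact DFunLike.congr_fun hp₁ x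
  · rw [he₂]
    exact DFunLike.congr_fun hp₂ x

theorem coloredClass_amalgamation [Countable T] (hU : IsStrictFraisse U) (hC : IsFraisseClass C)
    (hfree : IsFreeIn C U) (hT : AgeIn U T) {A B₁ B₂ : Bundled.{0} L.Structure} (hA : A ∈ C)
    (h₁ : B₁ ∈ C) (h₂ : B₂ ∈ C) (b₁ : B₁ →[L] T) (b₂ : B₂ →[L] T) (f₁ : A ↪[L] B₁)
    (f₂ : A ↪[L] B₂) (hf : ∀ x, b₁ (f₁ x) = b₂ (f₂ x)) :
    ∃ P ∈ C, ∃ (p : P →[L] T) (e₁ : B₁ ↪[L] P) (e₂ : B₂ ↪[L] P),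
      (∀ x, p (e₁ x) = b₁ x) ∧ (∀ x, p (e₂ x) = b₂ x) ∧ ∀ x, e₁ (f₁ x) = e₂ (f₂ x) := by
  obtain ⟨P, g₁, g₂, hP⟩ := hU.2.1 A B₁ B₂ (hfree.1 hA) (hfree.1 h₁) (hfree.1 h₂) f₁ f₂
  obtain ⟨D, hD, k₁, k₂, hk⟩ := hC.amalgamation A B₁ B₂ hA h₁ h₂ f₁ f₂
  obtain ⟨h, ⟨hh₁, hh₂⟩, -⟩ := hP.2.2 D (hU.1.inBar (hfree.1 hD)) k₁.toHom k₂.toHom hk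
  obtain ⟨p, ⟨hp₁, hp₂⟩, -⟩ := hP.2.2 ⟨T, inferInstance⟩ ⟨‹_›, hT⟩ b₁ b₂ hf
  obtain ⟨e₁, he₁⟩ := exists_embedding_of_comp_eq g₁ h k₁ hh₁
  obtain ⟨e₂, he₂⟩ := exists_embedding_of_comp_eq g₂ h k₂ hh₂
  refine ⟨P, hfree.2.1 A B₁ B₂ hA h₁ h₂ f₁ f₂ P g₁ g₂ hP, p, e₁, e₂, fun x => ?_, fun x => ?_,
    fun x => ?_⟩
  · rw [he₁]
    exact DFunLike.congr_fun hp₁ x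
  · rw [he₂]
    exact DFunLike.congr_fun hp₂ x
  · rw [he₁, he₂]
    exact hP.2.1 x

theorem isFraisseClass_coloredClass [L.IsRelational] [Countable T] (hU : IsStrictFraisse U)
    (hC : IsFraisseClass C) (hfree : IsFreeIn C U) (hT : AgeIn U T) :
    IsFraisseClass (coloredClass T C) where
  nonempty := hU.1.coloredClass_nonempty hC hfree.1 hT
  finite := by
    rintro M ⟨A, hA, a, ⟨e⟩⟩
    have : Finite (colored A a) := hC.finite A hA
    exact Finite.of_injective e e.injective
  isoInvariant M N h := by
    obtain ⟨f⟩ := h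
    constructor
    · rintro ⟨A, hA, a, ⟨e⟩⟩
      exact ⟨A, hA, a, ⟨e.comp f.symm⟩⟩
    · rintro ⟨A, hA, a, ⟨e⟩⟩
      exact ⟨A, hA, a, ⟨e.comp f⟩⟩
  countableTypes := hC.coloredClass_countableTypes
  hereditary := hC.coloredClass_hereditary
  jep := by
    rintro M ⟨B₁, h₁, b₁, ⟨e₁⟩⟩ N ⟨B₂, h₂, b₂, ⟨e₂⟩⟩
    obtain ⟨D, hD, ⟨g₁⟩, ⟨g₂⟩⟩ := coloredClass_jep hU hC hfree hT h₁ h₂ b₁ b₂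
    exact ⟨D, hD, ⟨g₁.comp e₁.toEmbedding⟩, ⟨g₂.comp e₂.toEmbedding⟩⟩
  amalgamation := by
    rintro M N₁ N₂ ⟨A, hA, a, ⟨e⟩⟩ ⟨B₁, h₁, b₁, ⟨e₁⟩⟩ ⟨B₂, h₂, b₂, ⟨e₂⟩⟩ f₁ f₂
    let f₁' : colored A a ↪[colorLang L T] colored B₁ b₁ :=
      e₁.toEmbedding.comp (f₁.comp e.symm.toEmbedding)
    let f₂' : colored A a ↪[colorLang L T] colored B₂ b₂ :=
      e₂.toEmbedding.comp (f₂.comp e.symm.toEmbedding)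
    obtain ⟨P, hP, p, k₁, k₂, hk₁, hk₂, hk⟩ := coloredClass_amalgamation hU hC hfree hT hA h₁ h₂
      b₁ b₂ (embeddingOfColored f₁') (embeddingOfColored f₂')
      (fun x => (color_eq_of_embedding f₁' x).trans (color_eq_of_embedding f₂' x).symm)
    refine ⟨_, colored_mem hP p, (coloredEmbedding k₁ hk₁).comp e₁.toEmbedding,
      (coloredEmbedding k₂ hk₂).comp e₂.toEmbedding, fun x => ?_⟩
    have h : k₁ (e₁ (f₁ (e.symm (e x)))) = k₂ (e₂ (f₂ (e.symm (e x)))) := hk (e x)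
    rw [e.symm_apply_apply] at h
    exact h

variable {A : Bundled.{0} L.Structure} {a : A →[L] T}

theorem IsRich.colUniversal [L.IsRelational]
    (hr : IsRich (coloredClass T C) (colored A a)) : ColUniversal C A a := by
  intro B b hB
  obtain ⟨g⟩ := hr.isUniversal _ (hB.colored b)
  exact ⟨embeddingOfColored g, color_eq_of_embedding g⟩

theorem IsRich.colHomogeneous [L.IsRelational] (hK : IsFraisseClass (coloredClass T C))
    (hA : InBar C A) (hr : IsRich (coloredClass T C) (colored A a)) : ColHomogeneous C A a := by
  intro B b hB hfin f₁ f₂ h₁ h₂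
  have hBC : B ∈ C := hB.2 B hfin ⟨Embedding.refl L B⟩
  obtain ⟨g, hg⟩ := hr.isHomogeneous hK (hA.colored a) _ (colored_mem hBC b)
    (coloredEmbedding f₁ h₁) (coloredEmbedding f₂ h₂)
  exact ⟨equivOfColored g, color_eq_of_embedding g.toEmbedding, hg⟩

theorem isRich_colored [L.IsRelational] (hK : IsFraisseClass (coloredClass T C))
    (hC : IsFraisseClass C) (hu : ColUniversal C A a) (hh : ColHomogeneous C A a) :
    IsRich (coloredClass T C) (colored A a) := by
  refine hK.isRich_of_universal_of_homogeneous (fun M hM => ?_) ?_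
  · obtain ⟨B, b, ⟨e⟩⟩ := exists_equiv_colored hM.2
    obtain ⟨f, hf⟩ := hu B b (hC.inBar_of_inBar_colored (hM.of_equiv e))
    exact ⟨(coloredEmbedding f hf).comp e.toEmbedding⟩
  · rintro M ⟨B, hB, b, ⟨e⟩⟩ f₁ f₂
    let g₁ : colored B b ↪[colorLang L T] colored A a := f₁.comp e.symm.toEmbedding
    let g₂ : colored B b ↪[colorLang L T] colored A a := f₂.comp e.symm.toEmbedding
    obtain ⟨g, hg, hgf⟩ := hh B b (hC.inBar hB) (hC.finite B hB) (embeddingOfColored g₁)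
      (embeddingOfColored g₂) (color_eq_of_embedding g₁) (color_eq_of_embedding g₂)
    refine ⟨coloredEquiv g hg, fun x => ?_⟩
    have h : g (f₁ (e.symm (e x))) = f₂ (e.symm (e x)) := hgf (e x)
    rw [e.symm_apply_apply] at h
    exact h

end Colored

/-- There exists a countable universal homogeneous `T`-colored structure
in `𝒞̄`, and it is unique up to isomorphism of `T`-colored structures. -/
theorem exists_unique_universal_homogeneous_colored (L : FirstOrder.Language.{u, v})
    [L.IsRelational] (U C : Set (Bundled.{0} L.Structure))
    (hU : IsStrictFraisse U) (hC : IsFraisseClass C) (hfree : IsFreeIn C U)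
    (T : Type) [L.Structure T] [Countable T] (hT : AgeIn U T) :
    ∃ (Ub : Bundled.{0} L.Structure) (u : Ub →[L] T), InBar C Ub ∧
      ColUniversal C Ub u ∧ ColHomogeneous C Ub u ∧
      ∀ (Ub' : Bundled.{0} L.Structure) (u' : Ub' →[L] T), InBar C Ub' →
        ColUniversal C Ub' u' → ColHomogeneous C Ub' u' →
        ∃ j : Ub ≃[L] Ub', ∀ x, u' (j x) = u x := by
  have hK := isFraisseClass_coloredClass hU hC hfree hT
  obtain ⟨M, hM, hr⟩ := hK.exists_isRich
  obtain ⟨A, a, ⟨e⟩⟩ := exists_equiv_colored hM.2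
  have hA : InBar C A := hC.inBar_of_inBar_colored (hM.of_equiv e)
  have hrA := hr.of_equiv e
  refine ⟨A, a, hA, hrA.colUniversal, hrA.colHomogeneous hK hA, fun B b hB hu hh => ?_⟩
  obtain ⟨j⟩ := IsRich.nonempty_equiv (hA.colored a) (hB.colored b) hrA
    (isRich_colored hK hC hu hh)
  exact ⟨equivOfColored j, color_eq_of_embedding j.toEmbedding⟩

end Stmt7
end
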